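/- arXiv:1709.08240 — 10 statements merged into one kernel-verified Lean document; each statement's English description precedes it below -/
import Mathlib

section
/- Let (Ω, 𝒜) be a measurable space, let U ⊆ ℂ be open, and let f : Ω × U → ℂ be such that f(ω, ·) is holomorphic on U for every ω ∈ Ω and f(·, z) is measurable for every z ∈ U. Let K ⊆ U be compact. Then there exists a sequence (R_m) of functions such that: each R_m has the form R_m(ω, z) = Σ_{j=1}^{N_m} a_j^m(ω)/(ζ_j^m − z) where the finitely many points ζ_j^m ∈ ℂ lie outside K and each coefficient function a_j^m : Ω → ℂ is measurable (so each R_m(ω, ·) is a rational function with no poles on K and each R_m(·, z) is measurable for z ≠ ζ_j^m); and for every ω ∈ Ω, the sequence R_m(ω, ·) converges to f(ω, ·) uniformly on K. -/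
open Filter MeasureTheory Set Topology

open Real in
/-- The Cauchy–Pompeiu formula for compactly supported functions, at the origin. -/
theorem integral_fderiv_add_I_mul_fderiv_div {v : ℂ → ℂ} (hv : ContDiff ℝ 1 v)
    (hc : HasCompactSupport v) :
    ∫ ζ : ℂ, (fderiv ℝ v ζ 1 + Complex.I * fderiv ℝ v ζ Complex.I) / ζ = -(2 * π) * v 0 := by
  have hd : Differentiable ℝ v := hv.differentiable (by simp)
  have hD : Continuous (fderiv ℝ v) := hv.continuous_fderiv (by simp)
  obtain ⟨R, hR⟩ : ∃ R : ℝ, ∀ ζ : ℂ, R < ‖ζ‖ → fderiv ℝ v ζ = 0 ∧ v ζ = 0 := by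
    obtain ⟨R, hR⟩ := hc.isCompact.isBounded.exists_norm_le
    refine ⟨R, fun ζ hζ => ?_⟩
    have h : ζ ∉ tsupport v := fun h => (hR ζ h).not_gt hζ
    exact ⟨image_eq_zero_of_notMem_tsupport fun h' => h (tsupport_fderiv_subset ℝ h'),
      image_eq_zero_of_notMem_tsupport h⟩
  set c : ℝ × ℝ → ℂ := fun p => p.1 * Complex.exp (p.2 * Complex.I)
  have hcc : Continuous c := by fun_prop
  have hcn (p : ℝ × ℝ) : ‖c p‖ = |p.1| := by simp [c, Complex.norm_exp_ofReal_mul_I]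
  set A : ℝ × ℝ → ℂ := fun p => fderiv ℝ v (c p) (Complex.exp (p.2 * Complex.I))
  set B : ℝ × ℝ → ℂ := fun p => fderiv ℝ v (c p) (Complex.I * Complex.exp (p.2 * Complex.I))
  have hint (F : ℝ × ℝ → ℂ) (hF : Continuous F) (h0 : ∀ p, R < |p.1| → F p = 0) :
      IntegrableOn F (Ioi 0 ×ˢ Ioo (-π) π) (volume.prod volume) := by
    have h1 : IntegrableOn F (Icc 0 R ×ˢ Icc (-π) π) (volume.prod volume) :=
      hF.continuousOn.integrableOn_compact (isCompact_Icc.prod isCompact_Icc)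
    refine h1.of_forall_sdiff_eq_zero (measurableSet_Ioi.prod measurableSet_Ioo) ?_
    rintro ⟨r, θ⟩ ⟨⟨hr, hθ⟩, h⟩
    refine h0 _ (lt_of_not_ge fun h' => h ⟨⟨le_of_lt hr, (le_abs_self r).trans h'⟩,
      Ioo_subset_Icc_self hθ⟩)
  have hAc : Continuous A := (hD.comp hcc).clm_apply (by fun_prop)
  have hBc : Continuous B := (hD.comp hcc).clm_apply (by fun_prop)
  have hA := hint A hAc fun p hp => by simp [A, (hR (c p) (by rwa [hcn])).1]
  have hB := hint B hBc fun p hp => by simp [B, (hR (c p) (by rwa [hcn])).1]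
  have hAint : ∫ p in Ioi 0 ×ˢ Ioo (-π) π, A p ∂(volume.prod volume) = -(2 * π) * v 0 := by
    rw [← setIntegral_prod_swap]
    refine (setIntegral_prod (fun z => A z.swap) hA.swap).trans ?_
    have hin (θ : ℝ) : ∫ r in Ioi (0 : ℝ), A (r, θ) = - v 0 := by
      have hder (r : ℝ) : HasDerivAt (fun r : ℝ => v (c (r, θ))) (A (r, θ)) r := by
        refine (hd _).hasFDerivAt.comp_hasDerivAt r ?_
        simpa [c] using (Complex.ofRealCLM.hasDerivAt (x := r)).mul_const
          (Complex.exp (θ * Complex.I))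
      have hcs : HasCompactSupport fun r => A (r, θ) :=
        HasCompactSupport.intro (isCompact_Icc (a := -R) (b := R)) fun r hr => by
          have : R < |r| := lt_of_not_ge fun h => hr (abs_le.1 h)
          simp [A, (hR (c (r, θ)) (by rwa [hcn])).1]
      rw [integral_Ioi_of_hasDerivAt_of_tendsto' (m := 0) (fun r _ => hder r)
        ((by fun_prop : Continuous fun r => A (r, θ)).integrable_of_hasCompactSupport
          hcs).integrableOn]
      · simp [c]
      · refine tendsto_const_nhds.congr' ?_
        filter_upwards [eventually_gt_atTop R] with r hr
        rw [(hR (c (r, θ)) (by rw [hcn]; exact hr.trans_le (le_abs_self r))).2]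
    simp only [Prod.swap, hin]
    rw [setIntegral_const, Real.volume_real_Ioo_of_le (by linarith [pi_pos]), Complex.real_smul]
    push_cast
    ring
  have hBint : ∫ p in Ioi 0 ×ˢ Ioo (-π) π, B p ∂(volume.prod volume) = 0 := by
    rw [setIntegral_prod _ hB]
    refine setIntegral_eq_zero_of_forall_eq_zero fun r hr => ?_
    have hr0 : (r : ℂ) ≠ 0 := by exact_mod_cast (ne_of_gt hr)
    have hder (θ : ℝ) : HasDerivAt (fun θ : ℝ => (r : ℂ)⁻¹ * v (c (r, θ))) (B (r, θ)) θ := by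
      have h1 : HasDerivAt (fun θ : ℝ => c (r, θ)) (r * (Complex.I * Complex.exp (θ * Complex.I)))
          θ := by
        have := ((Complex.ofRealCLM.hasDerivAt (x := θ)).mul_const Complex.I).cexp.const_mul (r : ℂ)
        simpa [c, mul_comm, mul_left_comm] using this
      refine (((hd (c (r, θ))).hasFDerivAt.comp_hasDerivAt θ h1).const_mul (r : ℂ)⁻¹).congr_deriv ?_
      rw [← Complex.real_smul (x := r), map_smul, Complex.real_smul, inv_mul_cancel_left₀ hr0]
    rw [← integral_Ioc_eq_integral_Ioo, ← intervalIntegral.integral_of_le (by linarith [pi_pos]),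
      intervalIntegral.integral_eq_sub_of_hasDerivAt (fun θ _ => hder θ)
        (by fun_prop : Continuous fun θ => B (r, θ)).continuousOn.intervalIntegrable]
    simp [c, Complex.exp_neg]
  rw [← Complex.integral_comp_polarCoord_symm]
  have key : ∀ p ∈ Ioi (0 : ℝ) ×ˢ Ioo (-π) π,
      p.1 • ((fderiv ℝ v (Complex.polarCoord.symm p) 1 +
        Complex.I * fderiv ℝ v (Complex.polarCoord.symm p) Complex.I) /
          Complex.polarCoord.symm p) = A p + Complex.I * B p := by
    rintro ⟨r, θ⟩ ⟨hr, -⟩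
    have hr0 : (r : ℂ) ≠ 0 := by exact_mod_cast (ne_of_gt hr)
    have hsymm : Complex.polarCoord.symm (r, θ) = c (r, θ) := by
      simp [c, Complex.exp_mul_I]
    have he : Complex.exp (θ * Complex.I) = Real.cos θ • (1 : ℂ) + Real.sin θ • Complex.I := by
      simp [Complex.exp_mul_I]
    have hie : Complex.I * Complex.exp (θ * Complex.I) =
        (-Real.sin θ) • (1 : ℂ) + Real.cos θ • Complex.I := by
      rw [he]; simp [mul_add, ← mul_assoc, mul_comm]; ring
    have hL (a b : ℝ) : fderiv ℝ v (c (r, θ)) (a • (1 : ℂ) + b • Complex.I) =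
        a * fderiv ℝ v (c (r, θ)) 1 + b * fderiv ℝ v (c (r, θ)) Complex.I := by
      rw [map_add, map_smul, map_smul, Complex.real_smul, Complex.real_smul]
    have hAv : A (r, θ) = _ := (congrArg (fderiv ℝ v (c (r, θ))) he).trans (hL _ _)
    have hBv : B (r, θ) = _ := (congrArg (fderiv ℝ v (c (r, θ))) hie).trans (hL _ _)
    rw [hAv, hBv, hsymm]
    generalize fderiv ℝ v _ 1 = x
    generalize fderiv ℝ v _ Complex.I = y
    have hcs : (Real.cos θ : ℂ) ^ 2 + (Real.sin θ : ℂ) ^ 2 = 1 := by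
      exact_mod_cast Real.cos_sq_add_sin_sq θ
    have hne := Complex.exp_ne_zero (θ * Complex.I)
    simp only [c]
    rw [Complex.real_smul, ← mul_div_assoc, mul_div_mul_left _ _ hr0, div_eq_iff hne, he,
      Complex.real_smul, Complex.real_smul]
    push_cast at *
    linear_combination (-(x + Complex.I * y)) * hcs + (Complex.sin θ ^ 2 * x -
      Complex.sin θ * Complex.cos θ * y) * Complex.I_sq
  refine (setIntegral_congr_fun (measurableSet_Ioi.prod measurableSet_Ioo) key).trans ?_
  refine (integral_add hA (hB.const_mul Complex.I)).trans ?_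
  refine (congrArg₂ (· + ·) hAint ((integral_const_mul Complex.I B).trans
    (congrArg (Complex.I * ·) hBint))).trans ?_
  simp

/-- The Cauchy–Pompeiu formula for compactly supported functions. -/
theorem integral_fderiv_add_I_mul_fderiv_div_sub {v : ℂ → ℂ} (hv : ContDiff ℝ 1 v)
    (hc : HasCompactSupport v) (z : ℂ) :
    ∫ ζ : ℂ, (fderiv ℝ v ζ 1 + Complex.I * fderiv ℝ v ζ Complex.I) / (ζ - z) =
      -(2 * Real.pi) * v z := by
  have h := integral_fderiv_add_I_mul_fderiv_div (v := fun ζ => v (ζ + z)) (by fun_prop)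
    (hc.comp_homeomorph (Homeomorph.addRight z))
  simp only [fderiv_comp_add_right, zero_add] at h
  rw [← h, ← integral_add_right_eq_self _ z]
  simp

/-- A compact set splits into finitely many measurable pieces of small diameter. -/
theorem IsCompact.exists_fin_partition_dist_lt {X : Type*} [PseudoMetricSpace X]
    [MeasurableSpace X] [OpensMeasurableSpace X] {L : Set X} (hL : IsCompact L)
    (hLm : MeasurableSet L) {δ : ℝ} (hδ : 0 < δ) :
    ∃ (N : ℕ) (p : Fin N → X) (A : Fin N → Set X), (∀ j, p j ∈ L) ∧
      (∀ j, MeasurableSet (A j)) ∧ Pairwise (Function.onFun Disjoint A) ∧ ⋃ j, A j = L ∧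
      ∀ j, ∀ x ∈ A j, dist x (p j) < δ := by
  obtain ⟨t, htL, htf, hcov⟩ := hL.finite_cover_balls hδ
  lift t to Finset X using htf
  set p : Fin t.card → X := fun j => (t.equivFin.symm j : X)
  set B : Fin t.card → Set X := fun j => L ∩ Metric.ball (p j) δ
  have hBm (j) : MeasurableSet (B j) := hLm.inter measurableSet_ball
  refine ⟨t.card, p, disjointed B, fun j => htL (t.equivFin.symm j).2,
    fun j => disjointedRec (p := MeasurableSet) (fun _ i h => h.diff (hBm i)) (hBm j),
    disjoint_disjointed B, ?_, fun j x hx => (disjointed_subset B j hx).2⟩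
  rw [iUnion_disjointed]
  refine subset_antisymm (iUnion_subset fun j => inter_subset_left) fun x hx => ?_
  obtain ⟨y, hy, hxy⟩ := mem_iUnion₂.1 (hcov hx)
  exact mem_iUnion.2 ⟨t.equivFin ⟨y, hy⟩, hx, by simpa [p] using hxy⟩

/-- On an open set `U`, functions holomorphic on `U` are recovered on a compact subset `K` by
integrating against the Cauchy kernel with a fixed continuous density on a compact subset
of `U \ K`. -/
theorem exists_cauchy_density {U K : Set ℂ} (hU : IsOpen U) (hK : IsCompact K) (hKU : K ⊆ U) :
    ∃ (L : Set ℂ) (g : ℂ → ℂ), IsCompact L ∧ L ⊆ U ∧ Disjoint L K ∧ Continuous g ∧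
      ∀ f : ℂ → ℂ, DifferentiableOn ℂ f U → ∀ z ∈ K,
        f z = ∫ ζ in L, f ζ / (ζ - z) * g ζ := by
  obtain ⟨V, hV, hKV, hVU, hVc⟩ := exists_open_between_and_isCompact_closure hK hU hKU
  obtain ⟨χ, hχ1, hχ0, -⟩ := exists_contMDiffMap_one_nhds_of_subset_interior
    (modelWithCornersSelf ℝ ℂ) (n := 1) hK.isClosed (hKV.trans hV.interior_eq.ge)
  set φ : ℂ → ℂ := fun ζ => χ ζ
  have hφ : ContDiff ℝ 1 φ := Complex.ofRealCLM.contDiff.comp χ.contMDiff.contDiff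
  have hD : Continuous (fderiv ℝ φ) := hφ.continuous_fderiv (by simp)
  obtain ⟨W, hW, hKW, hW1⟩ := mem_nhdsSet_iff_exists.1 hχ1
  have hsupp : tsupport φ ⊆ closure V := closure_mono fun ζ hζ => by
    by_contra h
    exact hζ (by simp [φ, hχ0 ζ h])
  set L := closure V \ W
  set h : ℂ → ℂ := fun ζ => fderiv ℝ φ ζ 1 + Complex.I * fderiv ℝ φ ζ Complex.I
  have hh : Continuous h := by fun_prop
  have hh0 (ζ) (hζ : ζ ∉ L) : fderiv ℝ φ ζ = 0 := by
    by_cases hζV : ζ ∈ closure V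
    · have hζW : ζ ∈ W := by_contra fun h' => hζ ⟨hζV, h'⟩
      have : φ =ᶠ[𝓝 ζ] fun _ => 1 := by
        filter_upwards [hW.mem_nhds hζW] with x hx
        simp [φ, show χ x = 1 from hW1 hx]
      rw [this.fderiv_eq]; simp
    · exact image_eq_zero_of_notMem_tsupport fun h' =>
        hζV (hsupp (tsupport_fderiv_subset ℝ h'))
  have hLc : IsCompact L := hVc.diff hW
  refine ⟨L, fun ζ => -(2 * Real.pi : ℂ)⁻¹ * h ζ, hLc, sdiff_subset.trans hVU,
    disjoint_left.2 fun ζ hζ hζK => hζ.2 (hKW hζK), by fun_prop, fun f hf z hz => ?_⟩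
  have hfR (ζ) (hζ : ζ ∈ U) : ContDiffAt ℝ 1 f ζ :=
    ((hf.contDiffOn hU).contDiffAt (hU.mem_nhds hζ)).restrict_scalars ℝ
  set v : ℂ → ℂ := fun ζ => φ ζ * f ζ
  have hvsupp : tsupport v ⊆ closure V := (closure_mono (Function.support_mul_subset_left φ f)).trans hsupp
  have hv : ContDiff ℝ 1 v := (contMDiff_of_tsupport fun ζ hζ =>
    (hφ.contDiffAt.mul (hfR ζ (hVU (hvsupp hζ)))).contMDiffAt).contDiff
  have hvc : HasCompactSupport v := hVc.of_isClosed_subset (isClosed_tsupport v) hvsupp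
  have hdv (ζ) : fderiv ℝ v ζ 1 + Complex.I * fderiv ℝ v ζ Complex.I = f ζ * h ζ := by
    by_cases hζ : ζ ∈ closure V
    · have hfd : DifferentiableAt ℂ f ζ := hf.differentiableAt (hU.mem_nhds (hVU hζ))
      have h2 := (hφ.differentiable (by simp) ζ).hasFDerivAt.mul
        (hfd.hasDerivAt.hasFDerivAt.restrictScalars ℝ)
      rw [show fderiv ℝ v ζ = _ from h2.fderiv]
      simp [h]
      linear_combination φ ζ * deriv f ζ * Complex.I_sq
    · rw [image_eq_zero_of_notMem_tsupport fun h' => hζ (hvsupp (tsupport_fderiv_subset ℝ h'))]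
      simp [h, hh0 ζ fun h' => hζ h'.1]
  have hP := integral_fderiv_add_I_mul_fderiv_div_sub hv hvc z
  simp only [hdv] at hP
  have hvz : v z = f z := by simp [v, φ, show χ z = 1 from hW1 (hKW hz)]
  rw [hvz] at hP
  have hpi : (2 * Real.pi : ℂ) ≠ 0 := by simp [Real.pi_ne_zero]
  calc f z = -(2 * Real.pi : ℂ)⁻¹ * (-(2 * Real.pi) * f z) := by field_simp
    _ = ∫ ζ, f ζ / (ζ - z) * (-(2 * Real.pi : ℂ)⁻¹ * h ζ) := by
      rw [← hP, ← integral_const_mul]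
      congr 1 with ζ
      ring
    _ = _ := (setIntegral_eq_integral_of_forall_compl_eq_zero fun ζ hζ => by
      simp [h, hh0 ζ hζ]).symm

/-- Riemann sums of a parametric integral over a compact set converge uniformly in the parameter
as the mesh of the partition tends to zero. -/
theorem exists_delta_norm_setIntegral_sub_sum_le {L K : Set ℂ} (hL : IsCompact L)
    (hK : IsCompact K) {F : ℂ → ℂ → ℂ} (hF : ContinuousOn (Function.uncurry F) (L ×ˢ K))
    {g : ℂ → ℂ} (hg : ContinuousOn g L) {ε : ℝ} (hε : 0 < ε) :
    ∃ δ > 0, ∀ (N : ℕ) (p : Fin N → ℂ) (A : Fin N → Set ℂ), (∀ j, p j ∈ L) →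
      (∀ j, MeasurableSet (A j)) → Pairwise (Function.onFun Disjoint A) → ⋃ j, A j = L →
      (∀ j, ∀ x ∈ A j, dist x (p j) < δ) → ∀ z ∈ K,
        ‖(∫ ζ in L, F ζ z * g ζ) - ∑ j, F (p j) z * ∫ ζ in A j, g ζ‖ < ε := by
  have hgi : IntegrableOn g L := hg.integrableOn_compact hL
  set M := ∫ ζ in L, ‖g ζ‖
  have hM : 0 ≤ M := integral_nonneg fun _ => norm_nonneg _
  have hη : 0 < ε / (M + 1) := by positivity
  obtain ⟨δ, hδ, hunif⟩ := Metric.uniformContinuousOn_iff.1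
    ((hL.prod hK).uniformContinuousOn_of_continuous hF) _ hη
  refine ⟨δ, hδ, fun N p A hp hA hAd hAL hAδ z hz => ?_⟩
  have hAsub (j) : A j ⊆ L := hAL ▸ subset_iUnion A j
  have hFi : IntegrableOn (fun ζ => F ζ z * g ζ) L :=
    ((hF.comp (by fun_prop : ContinuousOn (fun ζ => (ζ, z)) L)
      fun ζ hζ => ⟨hζ, hz⟩).mul hg).integrableOn_compact hL
  have hsplit (u : ℂ → ℂ) (hu : IntegrableOn u L) : ∫ ζ in L, u ζ = ∑ j, ∫ ζ in A j, u ζ := by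
    rw [← hAL]
    exact integral_iUnion_fintype hA hAd fun j => hu.mono_set (hAsub j)
  have hsplitn : M = ∑ j, ∫ ζ in A j, ‖g ζ‖ := by
    simp only [M]
    rw [← hAL]
    exact integral_iUnion_fintype hA hAd fun j => (hgi.mono_set (hAsub j)).norm
  rw [hsplit _ hFi, ← Finset.sum_sub_distrib]
  have hterm (j) : ‖(∫ ζ in A j, F ζ z * g ζ) - F (p j) z * ∫ ζ in A j, g ζ‖ ≤
      ε / (M + 1) * ∫ ζ in A j, ‖g ζ‖ := by
    have hgj := hgi.mono_set (hAsub j)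
    rw [← integral_const_mul, ← integral_sub (hFi.mono_set (hAsub j)) (hgj.const_mul _),
      ← integral_const_mul]
    refine norm_integral_le_of_norm_le (hgj.norm.const_mul _) ?_
    refine (ae_restrict_iff' (hA j)).2 (ae_of_all _ fun ζ hζ => ?_)
    rw [← sub_mul, norm_mul, ← dist_eq_norm]
    gcongr
    exact (hunif (ζ, z) ⟨hAsub j hζ, hz⟩ (p j, z) ⟨hp j, hz⟩
      (by simpa [Prod.dist_eq, hδ] using hAδ j ζ hζ)).le
  calc _ ≤ ∑ j, ε / (M + 1) * ∫ ζ in A j, ‖g ζ‖ := norm_sum_le_of_le _ fun j _ => hterm j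
    _ = ε / (M + 1) * M := by rw [← Finset.mul_sum, ← hsplitn]
    _ < ε := by rw [div_mul_eq_mul_div, div_lt_iff₀ (by positivity)]; nlinarith

/-- **Random Runge theorem (one variable).**
If `f : Ω × U → ℂ` is a random holomorphic function on an open set `U ⊆ ℂ`
(holomorphic in `z` for each `ω`, measurable in `ω` for each `z ∈ U`) and
`K ⊆ U` is compact, then there is a sequence `R m` of random rational functions
of the form `z ↦ ∑ j, a j ω / (ζ j - z)` with poles `ζ j` off `K` and
measurable coefficients `a j`, converging to `f ω` uniformly on `K`
for every `ω`. -/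
theorem random_runge_one_variable
    {Ω : Type*} [MeasurableSpace Ω] {U : Set ℂ} (hU : IsOpen U)
    (f : Ω → ℂ → ℂ)
    (hf_hol : ∀ ω, DifferentiableOn ℂ (f ω) U)
    (hf_meas : ∀ z ∈ U, Measurable fun ω => f ω z)
    {K : Set ℂ} (hK : IsCompact K) (hKU : K ⊆ U) :
    ∃ R : ℕ → Ω → ℂ → ℂ,
      (∀ m : ℕ, ∃ (N : ℕ) (ζ : Fin N → ℂ) (a : Fin N → Ω → ℂ),
        (∀ j, ζ j ∉ K) ∧
        (∀ j, Measurable (a j)) ∧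
        (∀ ω z, R m ω z = ∑ j : Fin N, a j ω / (ζ j - z))) ∧
      (∀ ω, TendstoUniformlyOn (fun m => R m ω) (f ω) atTop K) := by
  obtain ⟨L, g, hL, hLU, hLK, hg, hrep⟩ := exists_cauchy_density hU hK hKU
  choose N p A hp hA hAd hAL hAδ using fun m : ℕ =>
    hL.exists_fin_partition_dist_lt hL.measurableSet (δ := 1 / ((m : ℝ) + 1)) (by positivity)
  refine ⟨fun m ω z => ∑ j, (f ω (p m j) * ∫ ζ in A m j, g ζ) / (p m j - z),
    fun m => ⟨N m, p m, fun j ω => f ω (p m j) * ∫ ζ in A m j, g ζ,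
      fun j => disjoint_left.1 hLK (hp m j),
      fun j => (hf_meas _ (hLU (hp m j))).mul_const _, fun _ _ => rfl⟩, fun ω => ?_⟩
  rw [Metric.tendstoUniformlyOn_iff]
  intro ε hε
  have hF : ContinuousOn (Function.uncurry fun ζ z => f ω ζ / (ζ - z)) (L ×ˢ K) :=
    (((hf_hol ω).continuousOn.mono hLU).comp continuousOn_fst fun q hq => hq.1).div
      (by fun_prop) fun q hq => sub_ne_zero.2 (hLK.ne_of_mem hq.1 hq.2)
  obtain ⟨δ, hδ, happrox⟩ :=
    exists_delta_norm_setIntegral_sub_sum_le hL hK hF hg.continuousOn hε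
  filter_upwards [tendsto_one_div_add_atTop_nhds_zero_nat.eventually (gt_mem_nhds hδ)]
    with m hm z hz
  rw [dist_eq_norm, hrep (f ω) (hf_hol ω) z hz]
  simpa only [mul_div_right_comm] using happrox (N m) (p m) (A m) (hp m) (hA m) (hAd m) (hAL m)
    (fun j x hx => (hAδ m j x hx).trans hm) z hz
end

section
/- Let (Ω, 𝒜) be a measurable space and let f : Ω × 𝔻ⁿ → ℂ, where 𝔻ⁿ = {z ∈ ℂⁿ : |z_j| < 1 for j = 1,…,n} is the open unit polydisc, be such that f(ω, ·) is holomorphic on 𝔻ⁿ for every ω and f(·, z) is measurable for every z ∈ 𝔻ⁿ. Then there exist measurable functions a_α : Ω → ℂ, indexed by multi-indices α ∈ ℕⁿ, such that for every ω ∈ Ω and every z ∈ 𝔻ⁿ the power series Σ_α a_α(ω) z^α converges absolutely to f(ω, z). -/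
open MeasureTheory Set Filter Topology

/-- The multivariate geometric series. -/
theorem hasSum_prod_geometric {𝕜 : Type*} [NontriviallyNormedField 𝕜] [CompleteSpace 𝕜] {n : ℕ}
    (x : Fin n → 𝕜) (hx : ∀ j, ‖x j‖ < 1) :
    HasSum (fun α : Fin n → ℕ => ∏ j, x j ^ α j) (∏ j, (1 - x j)⁻¹) ∧
      Summable fun α : Fin n → ℕ => ‖∏ j, x j ^ α j‖ := by
  induction n with
  | zero => exact ⟨by simp [hasSum_unique],
      (hasSum_unique _).summable⟩
  | succ n ih =>
    obtain ⟨h, hs⟩ := ih (fun j => x j.succ) fun j => hx j.succ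
    have h0 := hasSum_geometric_of_norm_lt_one (hx 0)
    have h0s := summable_norm_geometric_of_norm_lt_one (hx 0)
    have key : (fun α : Fin (n + 1) → ℕ => ∏ j, x j ^ α j) ∘ Fin.consEquiv (fun _ => ℕ) =
        fun p : ℕ × (Fin n → ℕ) => x 0 ^ p.1 * ∏ j, x j.succ ^ p.2 j := by
      ext p
      simp [Fin.prod_univ_succ, Fin.consEquiv]
    constructor
    · rw [← (Fin.consEquiv fun _ => ℕ).hasSum_iff, key, Fin.prod_univ_succ]
      have hm := summable_mul_of_summable_norm (f := fun k => x 0 ^ k)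
        (g := fun α : Fin n → ℕ => ∏ j, x j.succ ^ α j) h0s hs
      have ht := tsum_mul_tsum_of_summable_norm (f := fun k => x 0 ^ k)
        (g := fun α : Fin n → ℕ => ∏ j, x j.succ ^ α j) h0s hs
      rw [h0.tsum_eq, h.tsum_eq] at ht
      rw [ht]
      exact hm.hasSum
    · rw [← (Fin.consEquiv fun _ => ℕ).summable_iff]
      have hk : (fun α : Fin (n + 1) → ℕ => ‖∏ j, x j ^ α j‖) ∘ Fin.consEquiv (fun _ => ℕ) =
          fun p : ℕ × (Fin n → ℕ) => ‖x 0 ^ p.1 * ∏ j, x j.succ ^ p.2 j‖ :=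
        funext fun p => congrArg norm (congrFun key p)
      rw [hk]
      exact Summable.mul_norm (f := fun k => x 0 ^ k)
        (g := fun α : Fin n → ℕ => ∏ j, x j.succ ^ α j) h0s hs

/-- A power series in one variable vanishing on a ball has zero coefficients. -/
theorem eq_zero_of_hasSum_mul_pow_eq_zero {c : ℕ → ℂ} {r : ℝ} (hr : 0 < r)
    (h : ∀ z : ℂ, ‖z‖ < r → HasSum (fun k => z ^ k * c k) 0) : c = 0 := by
  have hp : HasFPowerSeriesAt (0 : ℂ → ℂ) (FormalMultilinearSeries.ofScalars ℂ c) 0 := by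
    rw [hasFPowerSeriesAt_iff]
    filter_upwards [Metric.ball_mem_nhds (0 : ℂ) hr] with z hz
    simpa [FormalMultilinearSeries.coeff_ofScalars] using h z (by simpa using hz)
  exact (FormalMultilinearSeries.ofScalars_series_eq_zero ℂ).1 hp.eq_zero

/-- A power series in several variables vanishing on a polydisc has zero coefficients. -/
theorem eq_zero_of_hasSum_mul_prod_pow_eq_zero {n : ℕ} {c : (Fin n → ℕ) → ℂ} {r : ℝ} (hr : 0 < r)
    (h : ∀ z : Fin n → ℂ, (∀ j, ‖z j‖ < r) → HasSum (fun α => c α * ∏ j, z j ^ α j) 0) :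
    c = 0 := by
  induction n with
  | zero =>
    ext α
    have := (hasSum_unique (fun α : Fin 0 → ℕ => c α * ∏ j, (0 : Fin 0 → ℂ) j ^ α j)).unique
      (h 0 fun j => j.elim0)
    simp only [Finset.univ_eq_empty, Finset.prod_empty, mul_one] at this
    exact (congrArg c (Subsingleton.elim _ _)).trans this
  | succ n ih =>
    have main : ∀ k, (fun β : Fin n → ℕ => c (Fin.cons k β)) = 0 := by
      have hz (x : ℂ) (hx : ‖x‖ < r) (w : Fin n → ℂ) (hw : ∀ j, ‖w j‖ < r) :
          HasSum (fun p : ℕ × (Fin n → ℕ) =>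
            x ^ p.1 * (c (Fin.cons p.1 p.2) * ∏ j, w j ^ p.2 j)) 0 := by
        have := h (Fin.cons x w) (by intro j; cases j using Fin.cases <;> simp [hx, hw])
        rw [← (Fin.consEquiv fun _ => ℕ).hasSum_iff] at this
        refine this.congr_fun ?_
        intro p
        simp [Fin.prod_univ_succ, Fin.consEquiv]
        ring
      have hsum (w : Fin n → ℂ) (hw : ∀ j, ‖w j‖ < r) (k : ℕ) :
          Summable fun β : Fin n → ℕ => c (Fin.cons k β) * ∏ j, w j ^ β j := by
        have hr2 : ((r / 2 : ℝ) : ℂ) ≠ 0 := by exact_mod_cast (half_pos hr).ne'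
        have := (hz (r / 2 : ℝ) (by
          rw [Complex.norm_real, Real.norm_of_nonneg (half_pos hr).le]; exact half_lt_self hr)
          w hw).summable.prod_factor k
        exact (summable_mul_left_iff (pow_ne_zero k hr2)).1 this
      intro k
      refine ih fun w hw => ?_
      have hb := eq_zero_of_hasSum_mul_pow_eq_zero
        (c := fun k => ∑' β : Fin n → ℕ, c (Fin.cons k β) * ∏ j, w j ^ β j) hr fun x hx =>
        (hz x hx w hw).prod_fiberwise fun k => (hsum w hw k).hasSum.mul_left (x ^ k)
      have := (hsum w hw k).hasSum
      rwa [show _ = (0 : ℂ) from congrFun hb k] at this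
    ext α
    rw [← Fin.cons_self_tail α]
    exact congrFun (main (α 0)) (Fin.tail α)

theorem norm_torusMap_zero {n : ℕ} {r : ℝ} (hr : 0 ≤ r) (θ : Fin n → ℝ) (j : Fin n) :
    ‖torusMap 0 (fun _ => r) θ j‖ = r := by
  simp [torusMap, abs_of_nonneg hr]

theorem continuous_comp_torusMap {n : ℕ} {f : (Fin n → ℂ) → ℂ} {r : ℝ}
    (hf : ContinuousOn f {z | ∀ j, ‖z j‖ = r}) (hr : 0 ≤ r) :
    Continuous fun θ => f (torusMap 0 (fun _ => r) θ) :=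
  hf.comp_continuous (by unfold torusMap; fun_prop) fun θ j => norm_torusMap_zero hr θ j

theorem ContinuousOn.torusIntegrable {n : ℕ} {f : (Fin n → ℂ) → ℂ} {r : ℝ}
    (hf : ContinuousOn f {z | ∀ j, ‖z j‖ = r}) (hr : 0 ≤ r) :
    TorusIntegrable f 0 fun _ => r :=
  (continuous_comp_torusMap hf hr).continuousOn.integrableOn_compact isCompact_Icc

theorem sub_ne_zero_of_norm_lt {r : ℝ} {z w : ℂ} (hz : ‖z‖ = r) (hw : ‖w‖ < r) : z - w ≠ 0 :=
  sub_ne_zero.2 fun h => by subst h; exact hw.ne hz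

/-- Cauchy's integral formula on a polydisc. -/
theorem torusIntegral_prod_sub_inv_mul {n : ℕ} {f : (Fin n → ℂ) → ℂ} {r R : ℝ} (hr : 0 < r)
    (hrR : r < R) (hf : DifferentiableOn ℂ f {z | ∀ j, ‖z j‖ < R}) {w : Fin n → ℂ}
    (hw : ∀ j, ‖w j‖ < r) :
    torusIntegral (fun z => (∏ j, (z j - w j)⁻¹) * f z) 0 (fun _ => r) =
      (2 * Real.pi * Complex.I) ^ n * f w := by
  induction n with
  | zero => simp [Subsingleton.elim (0 : Fin 0 → ℂ) w]
  | succ n ih =>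
    rw [torusIntegral_succ]
    · have inner : ∀ x ∈ Metric.sphere (0 : ℂ) r,
          torusIntegral (fun y : Fin n → ℂ => (∏ j, ((Fin.cons x y : Fin (n + 1) → ℂ) j - w j)⁻¹) *
            f (Fin.cons x y)) 0 (fun _ => r) =
          (x - w 0)⁻¹ • ((2 * Real.pi * Complex.I) ^ n * f (Fin.cons x (Fin.tail w))) := by
        intro x hx
        have hx' : ‖x‖ = r := by simpa using hx
        have := ih (f := fun y => f (Fin.cons x y)) (w := Fin.tail w)
          (hf.comp (fun y _ => (differentiableAt_pi.2 fun j => by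
            cases j using Fin.cases <;> (simp; try fun_prop)).differentiableWithinAt)
            fun y hy j => by cases j using Fin.cases <;> simp_all) fun j => hw j.succ
        rw [← this, smul_eq_mul, ← torusIntegral_const_mul]
        simp [Fin.prod_univ_succ, mul_assoc, mul_left_comm, Fin.tail]
      have hd : DifferentiableOn ℂ (fun x => (2 * Real.pi * Complex.I) ^ n *
          f (Fin.cons x (Fin.tail w))) (Metric.closedBall 0 r) := by
        refine (hf.comp (fun y _ => (differentiableAt_pi.2 fun j => by
          cases j using Fin.cases <;> simp).differentiableWithinAt)
          fun x hx j => ?_).const_mul _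
        have hx' : ‖x‖ ≤ r := by simpa using hx
        cases j using Fin.cases with
        | zero => exact hx'.trans_lt hrR
        | succ j => exact (hw j.succ).trans hrR
      have hC := (hd.diffContOnCl_ball subset_rfl).circleIntegral_sub_inv_smul
        (w := w 0) (by simpa using hw 0)
      rw [← Fin.cons_self_tail w] at *
      refine (circleIntegral.integral_congr hr.le inner).trans (hC.trans ?_)
      simp [pow_succ]
      ring
    · refine ContinuousOn.torusIntegrable (ContinuousOn.mul ?_ (hf.continuousOn.mono ?_)) hr.le
      · refine continuousOn_finsetProd _ fun j _ => ContinuousOn.inv₀ (by fun_prop) ?_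
        exact fun z hz => sub_ne_zero_of_norm_lt (hz j) (hw j)
      · exact fun z hz j => (hz j).trans_lt hrR

/-- The Taylor coefficient at `0` of index `α`, as a Cauchy integral over the torus of
radius `r`. -/
noncomputable def torusCoeff {n : ℕ} (f : (Fin n → ℂ) → ℂ) (r : ℝ) (α : Fin n → ℕ) : ℂ :=
  ((2 * Real.pi * Complex.I) ^ n)⁻¹ *
    torusIntegral (fun z => (∏ j, (z j ^ (α j + 1))⁻¹) * f z) 0 fun _ => r

theorem hasSum_torusCoeff {n : ℕ} {f : (Fin n → ℂ) → ℂ} {r R : ℝ} (hr : 0 < r)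
    (hrR : r < R) (hf : DifferentiableOn ℂ f {z | ∀ j, ‖z j‖ < R}) {w : Fin n → ℂ}
    (hw : ∀ j, ‖w j‖ < r) :
    HasSum (fun α => torusCoeff f r α * ∏ j, w j ^ α j) (f w) := by
  have hpi : (2 * Real.pi * Complex.I) ^ n ≠ 0 := pow_ne_zero _ Complex.two_pi_I_ne_zero
  have hcont : Continuous fun θ => f (torusMap 0 (fun _ => r) θ) :=
    continuous_comp_torusMap (hf.continuousOn.mono fun z hz j => (hz j).trans_lt hrR) hr.le
  have hmap : Continuous (torusMap (0 : Fin n → ℂ) fun _ => r) := by unfold torusMap; fun_prop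
  have hne (θ : Fin n → ℝ) (j : Fin n) : torusMap 0 (fun _ => r) θ j ≠ 0 :=
    norm_ne_zero_iff.1 (by rw [norm_torusMap_zero hr.le]; exact hr.ne')
  obtain ⟨M, hM⟩ := (isCompact_Icc (a := (0 : Fin n → ℝ))
    (b := fun _ => 2 * Real.pi)).exists_bound_of_continuousOn hcont.continuousOn
  let q : Fin n → ℂ := fun j => w j / r
  have hq (j) : ‖q j‖ < 1 := by
    simpa [q, abs_of_pos hr, div_lt_one hr] using hw j
  have hqs := (hasSum_prod_geometric q hq).2
  have key : HasSum (fun α : Fin n → ℕ => torusIntegral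
      (fun z => (∏ j, (z j ^ (α j + 1))⁻¹) * f z) 0 (fun _ => r) * ∏ j, w j ^ α j)
      (torusIntegral (fun z => (∏ j, (z j - w j)⁻¹) * f z) 0 (fun _ => r)) := by
    simp only [torusIntegral, ← integral_mul_const]
    refine hasSum_integral_of_dominated_convergence
      (fun α _ => M * ‖∏ j, q j ^ α j‖) ?_ ?_ ?_ ?_ ?_
    · intro α
      refine Continuous.aestronglyMeasurable ?_
      have : Continuous fun θ => ∏ j : Fin n,
          (torusMap (0 : Fin n → ℂ) (fun _ => r) θ j ^ (α j + 1))⁻¹ :=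
        continuous_finsetProd _ fun j _ => Continuous.inv₀ (by fun_prop)
          fun θ => pow_ne_zero _ (hne θ j)
      exact ((Continuous.smul (f := fun θ : Fin n → ℝ =>
        ∏ j, ((r : ℂ) * Complex.exp (θ j * Complex.I) * Complex.I)) (by fun_prop)
        (this.mul hcont))).mul continuous_const
    · intro α
      filter_upwards [ae_restrict_mem measurableSet_Icc] with θ hθ
      have h1 : ‖(∏ j : Fin n, ((r : ℂ) * Complex.exp (θ j * Complex.I) * Complex.I)) •
          ((∏ j, (torusMap 0 (fun _ => r) θ j ^ (α j + 1))⁻¹) * f (torusMap 0 (fun _ => r) θ)) *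
          ∏ j, w j ^ α j‖ = ‖f (torusMap 0 (fun _ => r) θ)‖ * ‖∏ j, q j ^ α j‖ := by
        simp only [norm_smul, norm_mul, norm_prod, norm_inv, norm_pow, norm_torusMap_zero hr.le, q,
          norm_div, Complex.norm_exp_ofReal_mul_I, Complex.norm_I, Complex.norm_real,
          Real.norm_of_nonneg hr.le, div_pow, Finset.prod_div_distrib, Finset.prod_inv_distrib,
          pow_succ, Finset.prod_mul_distrib]
        have : ∏ _j : Fin n, r ≠ 0 := Finset.prod_ne_zero_iff.2 fun _ _ => hr.ne'
        field_simp
        simp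
      exact h1.trans_le (mul_le_mul_of_nonneg_right (hM θ hθ) (norm_nonneg _))
    · exact Eventually.of_forall fun _ => hqs.mul_left M
    · exact integrable_const_iff.2 (.inr ⟨by simp [isCompact_Icc.measure_lt_top]⟩)
    · refine Eventually.of_forall fun θ => ?_
      set ζ := torusMap 0 (fun _ => r) θ with hζ
      have hg := (hasSum_prod_geometric (fun j => w j / ζ j) fun j => by
        rw [norm_div, norm_torusMap_zero hr.le, div_lt_one hr]; exact hw j).1
      have := hg.mul_left ((∏ j : Fin n, ((r : ℂ) * Complex.exp (θ j * Complex.I) * Complex.I)) *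
        ((∏ j, (ζ j)⁻¹) * f ζ))
      convert this using 1
      · rfl
      · ext α
        simp only [smul_eq_mul, div_pow, Finset.prod_div_distrib, pow_succ, mul_inv,
          Finset.prod_mul_distrib, Finset.prod_inv_distrib]
        ring
      · have : ∀ j, (ζ j - w j)⁻¹ = (ζ j)⁻¹ * (1 - w j / ζ j)⁻¹ := fun j => by
          rw [← mul_inv, mul_sub, mul_one, mul_div_cancel₀ _ (hne θ j)]
        simp only [this, Finset.prod_mul_distrib, smul_eq_mul]
        ring
  rw [torusIntegral_prod_sub_inv_mul hr hrR hf hw] at key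
  have := key.mul_left ((2 * Real.pi * Complex.I) ^ n)⁻¹
  rw [inv_mul_cancel_left₀ hpi] at this
  simpa only [torusCoeff, mul_assoc] using this

/-- The Cauchy coefficients of a holomorphic function do not depend on the radius. -/
theorem torusCoeff_eq_torusCoeff {n : ℕ} {f : (Fin n → ℂ) → ℂ} {r s R : ℝ} (hr : 0 < r)
    (hrs : r ≤ s) (hsR : s < R) (hf : DifferentiableOn ℂ f {z | ∀ j, ‖z j‖ < R}) :
    torusCoeff f s = torusCoeff f r := by
  rw [← sub_eq_zero]
  refine eq_zero_of_hasSum_mul_prod_pow_eq_zero hr fun z hz => ?_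
  have := (hasSum_torusCoeff (hr.trans_le hrs) hsR hf fun j => (hz j).trans_le hrs).sub
    (hasSum_torusCoeff hr (hrs.trans_lt hsR) hf hz)
  simpa [sub_mul] using this

theorem measurable_torusCoeff {Ω : Type*} [MeasurableSpace Ω] {n : ℕ} {f : Ω → (Fin n → ℂ) → ℂ}
    {r : ℝ} (hr : 0 < r) (hf : ∀ ω, ContinuousOn (f ω) {z | ∀ j, ‖z j‖ = r})
    (hm : ∀ z ∈ {z : Fin n → ℂ | ∀ j, ‖z j‖ = r}, Measurable fun ω => f ω z) (α : Fin n → ℕ) :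
    Measurable fun ω => torusCoeff (f ω) r α := by
  refine Measurable.const_mul ?_ _
  have hu : Measurable (Function.uncurry fun (θ : Fin n → ℝ) ω =>
      f ω (torusMap 0 (fun _ => r) θ)) :=
    measurable_uncurry_of_continuous_of_measurable
      (fun ω => continuous_comp_torusMap (hf ω) hr.le)
      fun θ => hm _ fun j => norm_torusMap_zero hr.le θ j
  have hmap : Measurable (torusMap (0 : Fin n → ℂ) fun _ => r) :=
    Continuous.measurable (by unfold torusMap; fun_prop)
  refine (StronglyMeasurable.integral_prod_right (f := fun ω θ =>
    (∏ j : Fin n, ((r : ℂ) * Complex.exp (θ j * Complex.I) * Complex.I)) •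
      ((∏ j, (torusMap 0 (fun _ => r) θ j ^ (α j + 1))⁻¹) * f ω (torusMap 0 (fun _ => r) θ)))
    (Measurable.stronglyMeasurable ?_)).measurable
  have hu' : Measurable fun p : Ω × (Fin n → ℝ) => f p.1 (torusMap 0 (fun _ => r) p.2) :=
    hu.comp measurable_swap
  simp only [Function.uncurry_def]
  have h1 : Measurable fun θ : Fin n → ℝ =>
    (∏ j : Fin n, ((r : ℂ) * Complex.exp (θ j * Complex.I) * Complex.I)) := by fun_prop
  have h2 : Measurable fun θ : Fin n → ℝ =>
    (∏ j : Fin n, (torusMap 0 (fun _ => r) θ j ^ (α j + 1))⁻¹) := by fun_prop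
  exact (h1.comp measurable_snd).smul ((h2.comp measurable_snd).mul hu')

/-- **Random Taylor series on the polydisc.**
A random holomorphic function on the open unit polydisc `𝔻ⁿ ⊆ ℂⁿ` has a
representation as a random power series: there are measurable coefficient
functions `a α : Ω → ℂ`, indexed by multi-indices `α : Fin n → ℕ`, such that
for every `ω` and every `z` in the polydisc the series `∑ α, a α ω * z ^ α`
converges absolutely to `f ω z`. -/
theorem random_taylor_series_polydisc
    {Ω : Type*} [MeasurableSpace Ω] {n : ℕ}
    (f : Ω → (Fin n → ℂ) → ℂ)
    (hf_hol : ∀ ω, DifferentiableOn ℂ (f ω) {z : Fin n → ℂ | ∀ j, ‖z j‖ < 1})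
    (hf_meas : ∀ z ∈ {z : Fin n → ℂ | ∀ j, ‖z j‖ < 1},
      Measurable fun ω => f ω z) :
    ∃ a : (Fin n → ℕ) → Ω → ℂ,
      (∀ α, Measurable (a α)) ∧
      ∀ ω, ∀ z ∈ {z : Fin n → ℂ | ∀ j, ‖z j‖ < 1},
        Summable (fun α : Fin n → ℕ => ‖a α ω * ∏ j, z j ^ α j‖) ∧
        HasSum (fun α : Fin n → ℕ => a α ω * ∏ j, z j ^ α j) (f ω z) := by
  refine ⟨fun α ω => torusCoeff (f ω) (1 / 2) α, fun α => ?_, fun ω z hz => ?_⟩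
  · refine measurable_torusCoeff (by norm_num) (fun ω => (hf_hol ω).continuousOn.mono ?_)
      (fun z hz => hf_meas z ?_) α
    · exact fun z hz j => (hz j).trans_lt (by norm_num)
    · exact fun j => (hz j).trans_lt (by norm_num)
  · have hz1 : max ‖z‖ (1 / 2) < 1 :=
      max_lt ((pi_norm_lt_iff one_pos).2 hz) (by norm_num)
    obtain ⟨s, hs, hs1⟩ := exists_between hz1
    have hs2 : 1 / 2 < s := (le_max_right _ _).trans_lt hs
    have h := hasSum_torusCoeff (by linarith) hs1 (hf_hol ω) fun j =>
      (norm_le_pi_norm z j).trans_lt ((le_max_left _ _).trans_lt hs)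
    rw [torusCoeff_eq_torusCoeff (by norm_num) hs2.le hs1 (hf_hol ω)] at h
    exact ⟨h.summable.norm, h⟩
end

section
/- Let (Ω, 𝒜) be a measurable space and let U ⊆ ℂⁿ be an open set with the property that if z ∈ U then λz ∈ U for every λ ∈ ℂ with |λ| ≤ 1. Let f : Ω × U → ℂ be such that f(ω, ·) is holomorphic on U for every ω and f(·, z) is measurable for every z ∈ U. Then there exists a sequence (p_m) of functions p_m : Ω × ℂⁿ → ℂ such that each p_m(ω, ·) is a polynomial in z₁,…,zₙ whose coefficients are measurable functions of ω, and for every ω ∈ Ω and every compact K ⊆ U, the sequence p_m(ω, ·) converges to f(ω, ·) uniformly on K. -/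
open Filter

theorem differentiableOn_fderiv_apply_of_isOpen {E : Type*} [NormedAddCommGroup E]
    [NormedSpace ℂ E] [FiniteDimensional ℂ E] {U : Set E} (hU : IsOpen U) {f : E → ℂ}
    (hf : DifferentiableOn ℂ f U) (v : E) :
    DifferentiableOn ℂ (fun x => fderiv ℂ f x v) U := by
  borelize E
  let : NormedSpace ℝ E := NormedSpace.restrictScalars ℝ ℂ E
  have : SecondCountableTopology (E →L[ℂ] ℂ) :=
    haveI := FiniteDimensional.proper ℂ (E →L[ℂ] ℂ)
    inferInstance
  intro x₀ hx₀
  have hcont : ContinuousAt f x₀ := (hf.differentiableAt (hU.mem_nhds hx₀)).continuousAt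
  obtain ⟨ε, hε, hball⟩ := Metric.eventually_nhds_iff_ball.1
    ((hU.eventually_mem hx₀).and (hcont.norm.eventually_lt_const (lt_add_one _)))
  set C : ℝ := ‖f x₀‖ + 1
  set r := ε / 4 with hr
  have hr0 : 0 < r := by positivity
  have hsub : Metric.ball x₀ (4 * r) ⊆ U := fun y hy => (hball y (by
    convert hy using 2; rw [hr]; ring)).1
  have hC : ∀ y ∈ Metric.ball x₀ (4 * r), ‖f y‖ ≤ C := fun y hy => (hball y (by
    convert hy using 2; rw [hr]; ring)).2.le
  have hfd : ∀ y ∈ Metric.ball x₀ (2 * r), ‖fderiv ℂ f y‖ ≤ 2 * C / r := by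
    intro y hy
    have hyb : Metric.ball y r ⊆ Metric.ball x₀ (4 * r) :=
      Metric.ball_subset_ball' (by have := Metric.mem_ball.1 hy; linarith)
    refine Complex.norm_fderiv_le_div_of_mapsTo_ball (hf.mono (hyb.trans hsub)) ?_ hr0
    intro w hw
    rw [mem_closedBall_iff_norm]
    have h1 := hC w (hyb hw)
    have h2 := hC y (hyb (Metric.mem_ball_self hr0))
    linarith [norm_sub_le (f w) (f y)]
  set R := r / (‖v‖ + 1) with hR
  have hR0 : 0 < R := by positivity
  have hRv : R * ‖v‖ ≤ r := by
    rw [hR, div_mul_eq_mul_div, div_le_iff₀ (by positivity)]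
    nlinarith [norm_nonneg v]
  have hmem : ∀ x ∈ Metric.ball x₀ r, ∀ z ∈ Metric.closedBall (0 : ℂ) R,
      x + z • v ∈ Metric.ball x₀ (2 * r) := by
    intro x hx z hz
    rw [mem_closedBall_zero_iff] at hz
    rw [mem_ball_iff_norm] at hx ⊢
    calc ‖x + z • v - x₀‖ = ‖(x - x₀) + z • v‖ := by congr 1; abel
      _ ≤ ‖x - x₀‖ + ‖z • v‖ := norm_add_le _ _
      _ < r + r := add_lt_add_of_lt_of_le hx (by
        rw [norm_smul]; exact (mul_le_mul_of_nonneg_right hz (norm_nonneg v)).trans hRv)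
      _ = 2 * r := by ring
  have h24 : Metric.ball x₀ (2 * r) ⊆ U :=
    (Metric.ball_subset_ball (by linarith)).trans hsub
  have hdiff : ∀ y ∈ U, DifferentiableAt ℂ f y := fun y hy =>
    hf.differentiableAt (hU.mem_nhds hy)
  have hcm : ∀ θ, circleMap 0 R θ ∈ Metric.closedBall (0 : ℂ) R :=
    fun θ => circleMap_mem_closedBall _ hR0.le θ
  set c : ℝ → ℂ := fun θ => deriv (circleMap 0 R) θ * ((circleMap 0 R θ - 0) ^ 2)⁻¹ with hc
  have hne : ∀ θ, circleMap 0 R θ ≠ 0 := fun θ => circleMap_ne_center hR0.ne'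
  have hc_cont : Continuous c := by
    simp only [hc, deriv_circleMap, sub_zero]
    exact ((continuous_circleMap 0 R).mul continuous_const).mul
      (((continuous_circleMap 0 R).pow 2).inv₀ fun θ => pow_ne_zero 2 (hne θ))
  have hform : ∀ x ∈ Metric.ball x₀ r, fderiv ℂ f x v =
      (2 * Real.pi * Complex.I : ℂ)⁻¹ •
        ∫ θ in (0 : ℝ)..2 * Real.pi, c θ • f (x + circleMap 0 R θ • v) := by
    intro x hx
    have hline : ∀ z : ℂ, HasDerivAt (fun z : ℂ => x + z • v) v z := fun z => by
      simpa using ((hasDerivAt_id z).smul_const v).const_add x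
    have hx0 : x + (0 : ℂ) • v ∈ U := by
      simpa using h24 (hmem x hx 0 (by simpa using hR0.le))
    have hder : deriv (fun z : ℂ => f (x + z • v)) 0 = fderiv ℂ f x v := by
      simpa [Function.comp_def] using ((hdiff _ hx0).hasFDerivAt.comp_hasDerivAt (0 : ℂ) (hline 0)).deriv
    rw [← hder, ← Complex.two_pi_I_inv_smul_circleIntegral_sub_sq_inv_smul_of_differentiable
      (f := fun z : ℂ => f (x + z • v)) (U := (fun z : ℂ => x + z • v) ⁻¹' U) (hU.preimage (by fun_prop))
      (fun z hz => h24 (hmem x hx z hz))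
      (fun z hz => ((hdiff _ hz).comp z (hline z).differentiableAt).differentiableWithinAt)
      (Metric.mem_ball_self hR0)]
    simp only [circleIntegral, hc, smul_eq_mul, mul_assoc]
  have hline_cont : ∀ x : E, Continuous fun θ : ℝ => x + circleMap 0 R θ • v := fun x =>
    continuous_const.add ((continuous_circleMap 0 R).smul continuous_const)
  have hF_cont : ∀ x ∈ Metric.ball x₀ r,
      Continuous fun θ => c θ • f (x + circleMap 0 R θ • v) := fun x hx =>
    hc_cont.smul <| continuous_iff_continuousAt.2 fun θ =>
      ContinuousAt.comp (g := f) (hdiff _ (h24 (hmem x hx _ (hcm θ)))).continuousAt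
        (hline_cont x).continuousAt
  have hmain := (intervalIntegral.hasFDerivAt_integral_of_dominated_of_fderiv_le
    (μ := MeasureTheory.volume) (a := 0) (b := 2 * Real.pi) (𝕜 := ℂ) (x₀ := x₀)
    (F := fun x θ => c θ • f (x + circleMap 0 R θ • v))
    (F' := fun x θ => c θ • fderiv ℂ f (x + circleMap 0 R θ • v))
    (bound := fun θ => ‖c θ‖ * (2 * C / r)) (Metric.ball_mem_nhds x₀ hr0)
    ?_ ?_ ?_ ?_ ?_ ?_)
  · exact (hmain.differentiableAt.const_smul (2 * Real.pi * Complex.I : ℂ)⁻¹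
      |>.congr_of_eventuallyEq (eventually_of_mem (Metric.ball_mem_nhds x₀ hr0) hform)).differentiableWithinAt
  · filter_upwards [Metric.ball_mem_nhds x₀ hr0] with x hx
    exact (hF_cont x hx).aestronglyMeasurable
  · exact (hF_cont x₀ (Metric.mem_ball_self hr0)).intervalIntegrable _ _
  · exact hc_cont.aestronglyMeasurable.smul
      ((measurable_fderiv ℂ f).comp (hline_cont x₀).measurable).aestronglyMeasurable
  · refine Eventually.of_forall fun θ _ x hx => ?_
    rw [norm_smul]
    gcongr
    exact hfd _ (hmem x hx _ (hcm θ))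
  · exact (hc_cont.norm.mul continuous_const).intervalIntegrable _ _
  · refine Eventually.of_forall fun θ _ x hx => HasFDerivAt.const_smul ?_ (c θ)
    exact (hasFDerivAt_comp_add_right _).2 (hdiff _ (h24 (hmem x hx _ (hcm θ)))).hasFDerivAt

/-- The polynomial `z ↦ ∂ᵏ/∂tᵏ f (t z)` at `t = 0`, i.e. `k!` times the homogeneous part of
degree `k` of the Taylor expansion of `f` at the origin. -/
noncomputable def homogeneousTaylor {n : ℕ} :
    ℕ → ((Fin n → ℂ) → ℂ) → MvPolynomial (Fin n) ℂ
  | 0, f => MvPolynomial.C (f 0)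
  | k + 1, f =>
    ∑ i, MvPolynomial.X i * homogeneousTaylor k fun z => fderiv ℂ f z (Pi.single i 1)

theorem measurable_fderiv_apply_of_measurable {Ω E : Type*} [MeasurableSpace Ω]
    [NormedAddCommGroup E] [NormedSpace ℂ E] {U : Set E} (hU : IsOpen U) {f : Ω → E → ℂ}
    (hf_hol : ∀ ω, DifferentiableOn ℂ (f ω) U) (hf_meas : ∀ z ∈ U, Measurable fun ω => f ω z)
    (v : E) {z : E} (hz : z ∈ U) : Measurable fun ω => fderiv ℂ (f ω) z v := by
  have hu : Tendsto (fun m : ℕ => ((m : ℂ) + 1)⁻¹) atTop (nhds 0) := by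
    simpa using tendsto_one_div_add_atTop_nhds_zero_nat (𝕜 := ℂ)
  have hev : ∀ᶠ m : ℕ in atTop, z + ((m : ℂ) + 1)⁻¹ • v ∈ U := by
    have : Tendsto (fun m : ℕ => z + ((m : ℂ) + 1)⁻¹ • v) atTop (nhds z) := by
      simpa using (hu.smul_const v).const_add z
    exact this.eventually (hU.mem_nhds hz)
  obtain ⟨N, hN⟩ := eventually_atTop.1 hev
  refine measurable_of_tendsto_metrizable
    (f := fun (m : ℕ) ω => (((m + N : ℕ) : ℂ) + 1) •
      (f ω (z + (((m + N : ℕ) : ℂ) + 1)⁻¹ • v) - f ω z)) (fun m => ?_) ?_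
  · exact ((hf_meas _ (hN _ (Nat.le_add_left _ _))).sub (hf_meas z hz)).const_smul
      (((m + N : ℕ) : ℂ) + 1)
  · rw [tendsto_pi_nhds]
    intro ω
    have hd : HasLineDerivAt ℂ (f ω) (fderiv ℂ (f ω) z v) z v :=
      ((hf_hol ω).differentiableAt (hU.mem_nhds hz)).hasFDerivAt.hasLineDerivAt v
    have hu' : Tendsto (fun m : ℕ => ((m : ℂ) + 1)⁻¹) atTop (nhdsWithin 0 {0}ᶜ) :=
      tendsto_nhdsWithin_iff.2 ⟨hu, Eventually.of_forall fun m =>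
        inv_ne_zero (Nat.cast_add_one_ne_zero m)⟩
    have := (hd.tendsto_slope_zero.comp hu').comp (tendsto_add_atTop_nat N)
    simpa [Function.comp_def] using this

theorem measurable_coeff_homogeneousTaylor {Ω : Type*} [MeasurableSpace Ω] {n : ℕ}
    {U : Set (Fin n → ℂ)} (hU : IsOpen U) (h0 : 0 ∈ U) (k : ℕ) {f : Ω → (Fin n → ℂ) → ℂ}
    (hf_hol : ∀ ω, DifferentiableOn ℂ (f ω) U) (hf_meas : ∀ z ∈ U, Measurable fun ω => f ω z)
    (α : Fin n →₀ ℕ) : Measurable fun ω => (homogeneousTaylor k (f ω)).coeff α := by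
  classical
  induction k generalizing f α with
  | zero =>
    simp only [homogeneousTaylor, MvPolynomial.coeff_C]
    split_ifs
    · exact hf_meas 0 h0
    · exact measurable_const
  | succ k ih =>
    simp only [homogeneousTaylor, MvPolynomial.coeff_sum, MvPolynomial.coeff_X_mul']
    refine Finset.measurable_fun_sum _ fun i _ => ?_
    split_ifs
    · exact ih (fun ω => differentiableOn_fderiv_apply_of_isOpen hU (hf_hol ω) _)
        (fun z hz => measurable_fderiv_apply_of_measurable hU hf_hol hf_meas _ hz) _
    · exact measurable_const

theorem eval_homogeneousTaylor {n : ℕ} {U : Set (Fin n → ℂ)} (hU : IsOpen U) (h0 : 0 ∈ U)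
    (k : ℕ) {f : (Fin n → ℂ) → ℂ} (hf : DifferentiableOn ℂ f U) (z : Fin n → ℂ) :
    MvPolynomial.eval z (homogeneousTaylor k f) = iteratedDeriv k (fun t : ℂ => f (t • z)) 0 := by
  induction k generalizing f with
  | zero => simp [homogeneousTaylor]
  | succ k ih =>
    have hV : IsOpen ((fun t : ℂ => t • z) ⁻¹' U) := hU.preimage (by fun_prop)
    have hV0 : (0 : ℂ) ∈ (fun t : ℂ => t • z) ⁻¹' U := by simpa using h0
    have hline : ∀ t : ℂ, HasDerivAt (fun t : ℂ => t • z) z t := fun t => by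
      simpa using (hasDerivAt_id t).smul_const z
    have hd (i : Fin n) := differentiableOn_fderiv_apply_of_isOpen hU hf (Pi.single i 1)
    have hcd (i : Fin n) :
        ContDiffAt ℂ k (fun t : ℂ => fderiv ℂ f (t • z) (Pi.single i 1)) 0 := by
      refine (DifferentiableOn.analyticAt (s := (fun t : ℂ => t • z) ⁻¹' U) (fun t ht => ?_)
        (hV.mem_nhds hV0)).contDiffAt
      exact (DifferentiableAt.comp (g := fun w => fderiv ℂ f w (Pi.single i 1)) t
        ((hd i).differentiableAt (hU.mem_nhds ht))
        (hline t).differentiableAt).differentiableWithinAt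
    have hderiv : deriv (fun t : ℂ => f (t • z)) =ᶠ[nhds 0]
        fun t => ∑ i, z i * fderiv ℂ f (t • z) (Pi.single i 1) := by
      filter_upwards [hV.mem_nhds hV0] with t ht
      have h1 := ((hf.differentiableAt (hU.mem_nhds ht)).hasFDerivAt.comp_hasDerivAt t
        (hline t)).deriv
      rw [Function.comp_def] at h1
      rw [h1]
      generalize fderiv ℂ f (t • z) = L
      conv_lhs => rw [pi_eq_sum_univ' z]
      simp [map_sum]
    rw [iteratedDeriv_succ', hderiv.iteratedDeriv_eq,
      iteratedDeriv_fun_sum fun i _ => contDiffAt_const.mul (hcd i)]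
    simp only [homogeneousTaylor, map_sum, map_mul, MvPolynomial.eval_X]
    refine Finset.sum_congr rfl fun i _ => ?_
    rw [ih (hd i), iteratedDeriv_const_mul_field]

theorem tendstoUniformlyOn_sum_iteratedDeriv_of_balanced {E : Type*} [NormedAddCommGroup E]
    [NormedSpace ℂ E] {U K : Set E} (hU : IsOpen U)
    (hbal : ∀ z ∈ U, ∀ l : ℂ, ‖l‖ ≤ 1 → l • z ∈ U) {f : E → ℂ}
    (hf : DifferentiableOn ℂ f U) (hK : IsCompact K) (hKU : K ⊆ U) :
    TendstoUniformlyOn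
      (fun m z => ∑ k ∈ Finset.range m,
        (k.factorial : ℂ)⁻¹ * iteratedDeriv k (fun t : ℂ => f (t • z)) 0) f atTop K := by
  obtain ⟨r, hr1, hrU⟩ : ∃ r : ℝ, 1 < r ∧ ∀ z ∈ K, (r : ℂ) • z ∈ U := by
    have hev : ∀ᶠ r : ℝ in nhds 1, ∀ z ∈ K, (r : ℂ) • z ∈ U := by
      refine hK.eventually_forall_of_forall_eventually fun z hz => ?_
      have : ContinuousAt (fun p : ℝ × E => (p.1 : ℂ) • p.2) (1, z) := by fun_prop
      exact this.eventually (hU.mem_nhds (by simpa using hKU hz))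
    obtain ⟨r, h1, h2⟩ := ((hev.filter_mono nhdsWithin_le_nhds).and
      (self_mem_nhdsWithin : Set.Ioi (1 : ℝ) ∈ nhdsWithin 1 (Set.Ioi 1))).exists
    exact ⟨r, h2, h1⟩
  have hr0 : 0 < r := by linarith
  have hmem : ∀ z ∈ K, ∀ t ∈ Metric.closedBall (0 : ℂ) r, t • z ∈ U := by
    intro z hz t ht
    have := hbal _ (hrU z hz) (t / r) (by
      rw [mem_closedBall_zero_iff] at ht
      rw [norm_div, Complex.norm_real, Real.norm_of_nonneg hr0.le]
      exact (div_le_one hr0).2 ht)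
    rwa [smul_smul, div_mul_cancel₀ _ (Complex.ofReal_ne_zero.2 hr0.ne')] at this
  obtain ⟨M, hM⟩ : ∃ M, ∀ z ∈ K, ∀ t ∈ Metric.closedBall (0 : ℂ) r, ‖f (t • z)‖ ≤ M := by
    have hcomp : IsCompact ((fun p : ℂ × E => p.1 • p.2) '' (Metric.closedBall (0 : ℂ) r ×ˢ K)) :=
      ((isCompact_closedBall _ _).prod hK).image (by fun_prop)
    obtain ⟨M, hM⟩ := hcomp.exists_bound_of_continuousOn (f := f) (hf.continuousOn.mono (by
      rintro _ ⟨⟨t, z⟩, ⟨ht, hz⟩, rfl⟩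
      exact hmem z hz t ht))
    exact ⟨M, fun z hz t ht => hM _ ⟨(t, z), ⟨ht, hz⟩, rfl⟩⟩
  have hdiff : ∀ z ∈ K, DifferentiableOn ℂ (fun t : ℂ => f (t • z)) (Metric.closedBall 0 r) :=
    fun z hz => hf.comp (by fun_prop) (hmem z hz)
  have hbound : ∀ (k : ℕ) (z : E), z ∈ K →
      ‖(k.factorial : ℂ)⁻¹ * iteratedDeriv k (fun t : ℂ => f (t • z)) 0‖ ≤ M * r⁻¹ ^ k := by
    intro k z hz
    have h := Complex.norm_iteratedDeriv_le_of_forall_mem_sphere_norm_le k hr0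
      (DifferentiableOn.diffContOnCl ((hdiff z hz).mono Metric.closure_ball_subset_closedBall))
      (fun t ht => hM z hz t (Metric.sphere_subset_closedBall ht))
    have hk : (0 : ℝ) < k.factorial := by exact_mod_cast k.factorial_pos
    rw [norm_mul, norm_inv, Complex.norm_natCast, inv_mul_le_iff₀ hk]
    refine h.trans (le_of_eq ?_)
    rw [inv_pow]
    ring
  refine (tendstoUniformlyOn_tsum_nat ((summable_geometric_of_lt_one (by positivity)
    (inv_lt_one_of_one_lt₀ hr1)).mul_left M) hbound).congr_right fun z hz => ?_
  have h := Complex.taylorSeries_eq_on_ball' (z := 1) (c := 0) (r := r) (by simpa using hr1)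
    ((hdiff z hz).mono Metric.ball_subset_closedBall)
  simpa using h

/-- **Random polynomial approximation on balanced open sets.**
Let `U ⊆ ℂⁿ` be open and balanced (`z ∈ U → λz ∈ U` for `|λ| ≤ 1`), and let
`f` be a random holomorphic function on `U`.  Then there is a sequence of
random polynomials `p m` (polynomials in `z` with measurable coefficients)
such that for every `ω` and every compact `K ⊆ U`, `p m ω` converges to
`f ω` uniformly on `K`. -/
theorem random_polynomial_approx_balanced
    {Ω : Type*} [MeasurableSpace Ω] {n : ℕ}
    {U : Set (Fin n → ℂ)} (hU : IsOpen U)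
    (hbal : ∀ z ∈ U, ∀ l : ℂ, ‖l‖ ≤ 1 → (fun j => l * z j) ∈ U)
    (f : Ω → (Fin n → ℂ) → ℂ)
    (hf_hol : ∀ ω, DifferentiableOn ℂ (f ω) U)
    (hf_meas : ∀ z ∈ U, Measurable fun ω => f ω z) :
    ∃ p : ℕ → Ω → MvPolynomial (Fin n) ℂ,
      (∀ m, ∀ α : Fin n →₀ ℕ, Measurable fun ω => (p m ω).coeff α) ∧
      ∀ ω, ∀ K : Set (Fin n → ℂ), IsCompact K → K ⊆ U →
        TendstoUniformlyOn (fun m z => MvPolynomial.eval z (p m ω)) (f ω)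
          atTop K := by
  rcases U.eq_empty_or_nonempty with rfl | ⟨z₀, hz₀⟩
  · refine ⟨fun _ _ => 0, fun _ _ => measurable_const, fun ω K _ hK => ?_⟩
    rw [Set.subset_empty_iff.1 hK]
    exact tendstoUniformlyOn_empty
  have h0 : (0 : Fin n → ℂ) ∈ U := by
    convert hbal z₀ hz₀ 0 (by simp) using 1
    ext j
    simp
  refine ⟨fun m ω => ∑ k ∈ Finset.range m,
    MvPolynomial.C (k.factorial : ℂ)⁻¹ * homogeneousTaylor k (f ω), fun m α => ?_,
    fun ω K hK hKU => ?_⟩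
  · simp only [MvPolynomial.coeff_sum, MvPolynomial.coeff_C_mul]
    exact Finset.measurable_fun_sum _ fun k _ =>
      (measurable_coeff_homogeneousTaylor hU h0 k hf_hol hf_meas α).const_mul _
  · simpa only [map_sum, map_mul, MvPolynomial.eval_C, eval_homogeneousTaylor hU h0 _ (hf_hol ω)]
      using tendstoUniformlyOn_sum_iteratedDeriv_of_balanced hU hbal (hf_hol ω) hK hKU
end

section
/- Let (Ω, 𝒜) be a measurable space, X a compact metric space, and g : Ω × X → ℂⁿ a function such that g(ω, ·) is continuous for every ω ∈ Ω and g(·, x) is measurable for every x ∈ X. Then the image map X^g : Ω → 𝒦'(ℂⁿ) defined by X^g(ω) = g(ω, X) = {g(ω, x) : x ∈ X} is a random compact set, i.e. it is measurable with respect to the Borel σ-algebra of the Hausdorff distance on 𝒦'(ℂⁿ). -/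
open TopologicalSpace

/-- Borel σ-algebra on the space `𝒦'(X)` of nonempty compact subsets of a
metric space `X`, equipped with the Hausdorff distance. -/
noncomputable instance nonemptyCompactsMeasurableSpace
    {X : Type*} [MetricSpace X] :
    MeasurableSpace (NonemptyCompacts X) := borel _

open Filter Topology

instance nonemptyCompactsBorelSpace {X : Type*} [MetricSpace X] :
    BorelSpace (NonemptyCompacts X) := ⟨rfl⟩

/-- An increasing sequence of nonempty compact sets whose union is a dense subset of a compact set
`L` converges to `L` in the Vietoris topology. -/
theorem NonemptyCompacts.tendsto_atTop_of_monotone {α : Type*} [TopologicalSpace α]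
    {K : ℕ → NonemptyCompacts α} {L : NonemptyCompacts α} (hK : Monotone K)
    (hKL : ∀ N, K N ≤ L) (hL : (L : Set α) ⊆ closure (⋃ N, (K N : Set α))) :
    Tendsto K atTop (𝓝 L) := by
  let := TopologicalSpace.vietoris α
  rw [NonemptyCompacts.isEmbedding_coe.tendsto_nhds_iff, tendsto_nhds_generateFrom_iff]
  rintro _ (⟨U, hU, rfl⟩ | ⟨U, hU, rfl⟩) hLU
  · exact Eventually.of_forall fun N => Set.Subset.trans (hKL N) hLU
  · obtain ⟨x, hxL, hxU⟩ := hLU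
    obtain ⟨y, hyU, hy⟩ := mem_closure_iff.1 (hL hxL) U hU hxU
    obtain ⟨M, hM⟩ := Set.mem_iUnion.1 hy
    filter_upwards [eventually_ge_atTop M] with N hN
    exact ⟨y, hK hN hM, hyU⟩

/-- Finite suprema of measurable maps into nonempty compact sets are measurable. -/
theorem measurable_partialSups_nonemptyCompacts {Ω E : Type*} [MeasurableSpace Ω] [MetricSpace E]
    [SecondCountableTopology E] {f : ℕ → Ω → NonemptyCompacts E} (hf : ∀ i, Measurable (f i))
    (N : ℕ) : Measurable fun ω => partialSups (fun i => f i ω) N := by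
  induction N with
  | zero => simpa using hf 0
  | succ N ih =>
    simp only [partialSups_add_one]
    exact continuous_sup.measurable.comp (ih.prodMk (hf (N + 1)))

/-- **The image of a compact space under a random continuous function is a
random compact set.** If `X` is a (nonempty) compact metric space and
`g : Ω × X → ℂⁿ` is continuous in `x` for each `ω` and measurable in `ω` for
each `x`, then `ω ↦ g(ω, X) = {g ω x : x ∈ X}` is a random compact set
in `ℂⁿ`. -/
theorem image_random_compact
    {Ω : Type*} [MeasurableSpace Ω]
    {X : Type*} [MetricSpace X] [CompactSpace X] [Nonempty X] {n : ℕ}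
    (g : Ω → X → (Fin n → ℂ))
    (hc : ∀ ω, Continuous (g ω))
    (hm : ∀ x, Measurable fun ω => g ω x) :
    Measurable (fun ω =>
      (⟨⟨Set.range (g ω), isCompact_range (hc ω)⟩,
        Set.range_nonempty _⟩ : NonemptyCompacts (Fin n → ℂ))) := by
  let u := denseSeq X
  refine measurable_of_tendsto_metrizable (f := fun N ω =>
    partialSups (fun i => ({g ω (u i)} : NonemptyCompacts (Fin n → ℂ))) N) (fun N => ?_)
    (tendsto_pi_nhds.2 fun ω => ?_)
  · exact measurable_partialSups_nonemptyCompacts (fun i =>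
      NonemptyCompacts.continuous_singleton.measurable.comp (hm (u i))) N
  · refine NonemptyCompacts.tendsto_atTop_of_monotone (partialSups _).monotone
      (fun N => partialSups_le _ _ _ fun i _ => ?_) ?_
    · rintro _ rfl
      exact Set.mem_range_self (u i)
    · refine ((hc ω).range_subset_closure_image_dense (denseRange_denseSeq X)).trans
        (closure_mono ?_)
      rintro _ ⟨_, ⟨i, rfl⟩, rfl⟩
      exact Set.mem_iUnion.2 ⟨i, le_partialSups (fun i =>
        ({g ω (u i)} : NonemptyCompacts (Fin n → ℂ))) i rfl⟩
end

section
/- Let (Ω, 𝒜) be a measurable space and K : Ω → 𝒦'(ℂⁿ) a random compact set. Then its polynomially convex hull \hat K, defined pointwise by \hat K(ω) = \hat{K(ω)} (which is a nonempty compact subset of ℂⁿ), is a random compact set, i.e. ω ↦ \hat{K(ω)} is measurable from Ω to 𝒦'(ℂⁿ). -/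
open TopologicalSpace MvPolynomial

/-- The polynomially convex hull of a set `K ⊆ ℂⁿ`: the set of points `z`
such that `|p z| ≤ max_{x ∈ K} |p x|` for every polynomial `p` in `n`
complex variables. -/
noncomputable def polyHull {n : ℕ} (K : Set (Fin n → ℂ)) : Set (Fin n → ℂ) :=
  {z | ∀ p : MvPolynomial (Fin n) ℂ,
    ‖eval z p‖ ≤ sSup ((fun x => ‖eval x p‖) '' K)}

namespace TopologicalSpace.NonemptyCompacts

theorem le_sSup_image_iff {X : Type*} [TopologicalSpace X] {f : X → ℝ} (hf : Continuous f)
    (K : NonemptyCompacts X) (a : ℝ) :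
    a ≤ sSup (f '' (K : Set X)) ↔ ∃ x ∈ K, a ≤ f x := by
  obtain ⟨x, hx, hsup⟩ := K.isCompact.exists_sSup_image_eq K.nonempty hf.continuousOn
  refine ⟨fun h => ⟨x, hx, hsup ▸ h⟩, ?_⟩
  rintro ⟨y, hy, hay⟩
  exact hay.trans (le_csSup (K.isCompact.image hf).bddAbove (Set.mem_image_of_mem f hy))

/-- The supremum of a continuous function over a nonempty compact set is upper semicontinuous in
the set. -/
theorem isClosed_setOfPred_le_sSup_image {X Y : Type*} [TopologicalSpace X] [TopologicalSpace Y]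
    {f : X → ℝ} {g : Y → ℝ} (hf : Continuous f) (hg : Continuous g) :
    IsClosed {q : Y × NonemptyCompacts X | g q.1 ≤ sSup (f '' (q.2 : Set X))} := by
  rw [← isOpen_compl_iff, isOpen_iff_mem_nhds]
  rintro ⟨y, K⟩ hq
  have hlt : sSup (f '' (K : Set X)) < g y := not_le.mp fun h => hq h
  obtain ⟨a, hKa, hay⟩ := exists_between hlt
  have hK : (K : Set X) ⊆ {x | f x < a} := fun x hx =>
    (le_csSup (K.isCompact.image hf).bddAbove (Set.mem_image_of_mem f hx)).trans_lt hKa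
  filter_upwards [prod_mem_nhds ((isOpen_lt continuous_const hg).mem_nhds hay)
    ((isOpen_subsets_of_isOpen (isOpen_lt hf continuous_const)).mem_nhds hK)]
  rintro ⟨z, L⟩ ⟨hz, hL⟩ h
  obtain ⟨x, hx, hzx⟩ := (le_sSup_image_iff hf L (g z)).mp h
  exact lt_irrefl _ ((hz.trans_le hzx).trans (hL hx))

/-- A map into the nonempty compact subsets of a locally compact, second countable
metric space is measurable as soon as all hitting sets of compact sets are measurable. -/
theorem measurable_of_isCompact {Ω X : Type*} [MeasurableSpace Ω] [MetricSpace X]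
    [LocallyCompactSpace X] [SecondCountableTopology X] {K : Ω → NonemptyCompacts X}
    (h : ∀ C : Set X, IsCompact C → MeasurableSet {ω | ((K ω : Set X) ∩ C).Nonempty}) :
    Measurable K := by
  have hsigma (S : Set X) (hS : IsSigmaCompact S) :
      MeasurableSet {ω | ((K ω : Set X) ∩ S).Nonempty} := by
    obtain ⟨C, hC, rfl⟩ := hS
    simp only [Set.inter_iUnion, Set.nonempty_iUnion, Set.ofPred_exists]
    exact MeasurableSet.iUnion fun i => h (C i) (hC i)
  have hhit (U : Set X) (hU : IsOpen U) : MeasurableSet {ω | ((K ω : Set X) ∩ U).Nonempty} := by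
    have := hU.locallyCompactSpace
    exact hsigma U (isSigmaCompact_iff_sigmaCompactSpace.mpr inferInstance)
  have hsub (U : Set X) (hU : IsOpen U) : MeasurableSet {ω | (K ω : Set X) ⊆ U} := by
    have hcompl := hsigma Uᶜ
      (isSigmaCompact_univ.of_isClosed_subset hU.isClosed_compl (Set.subset_univ _))
    convert hcompl.compl using 1
    ext ω
    simp [Set.inter_compl_nonempty_iff]
  have hborel : nonemptyCompactsMeasurableSpace (X := X) = MeasurableSpace.generateFrom _ :=
    borel_eq_generateFrom_of_subbasis
      (show NonemptyCompacts.topology (α := X) = _ from induced_generateFrom_eq)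
  rw [hborel]
  refine measurable_generateFrom ?_
  rintro _ ⟨_, ⟨U, hU, rfl⟩ | ⟨U, hU, rfl⟩, rfl⟩
  · exact hsub U hU
  · exact hhit U hU

end TopologicalSpace.NonemptyCompacts

/-- The graph of the polynomially convex hull is closed. -/
theorem isClosed_setOfPred_mem_polyHull (n : ℕ) :
    IsClosed {q : (Fin n → ℂ) × NonemptyCompacts (Fin n → ℂ) | q.1 ∈ polyHull (q.2 : Set _)} := by
  have hcont (p : MvPolynomial (Fin n) ℂ) : Continuous fun x => ‖eval x p‖ :=
    (MvPolynomial.continuous_eval p).norm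
  simp only [polyHull, Set.mem_ofPred_eq]
  simp only [Set.ofPred_forall]
  exact isClosed_iInter fun p =>
    NonemptyCompacts.isClosed_setOfPred_le_sSup_image (hcont p) (hcont p)

theorem isClosed_setOfPred_polyHull_inter_nonempty {n : ℕ} {C : Set (Fin n → ℂ)} (hC : IsCompact C) :
    IsClosed {K : NonemptyCompacts (Fin n → ℂ) | (polyHull (K : Set _) ∩ C).Nonempty} := by
  have := isCompact_iff_compactSpace.mp hC
  convert isClosedMap_snd_of_compactSpace _ ((isClosed_setOfPred_mem_polyHull n).preimage
    ((continuous_subtype_val (p := (· ∈ C))).prodMap continuous_id)) using 1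
  ext K
  simp [Set.Nonempty, and_comm]

/-- **The polynomially convex hull of a random compact set is a random
compact set.** If `K : Ω → 𝒦'(ℂⁿ)` is measurable and `Khat : Ω → 𝒦'(ℂⁿ)`
is defined pointwise by `Khat ω = (K ω)^` (the polynomially convex hull,
which is a nonempty compact set), then `Khat` is measurable. -/
theorem polyHull_random_compact
    {Ω : Type*} [MeasurableSpace Ω] {n : ℕ}
    (K : Ω → NonemptyCompacts (Fin n → ℂ)) (hK : Measurable K)
    (Khat : Ω → NonemptyCompacts (Fin n → ℂ))
    (hKhat : ∀ ω, (Khat ω : Set (Fin n → ℂ)) = polyHull (K ω)) :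
    Measurable Khat := by
  refine NonemptyCompacts.measurable_of_isCompact fun C hC => ?_
  simp only [hKhat]
  have : BorelSpace (NonemptyCompacts (Fin n → ℂ)) := ⟨rfl⟩
  exact hK (isClosed_setOfPred_polyHull_inter_nonempty hC).measurableSet
end

section
/- The mapping 𝒦'(ℂⁿ) → 𝒦'(ℂⁿ) sending each nonempty compact set K to its polynomially convex hull \hat K is Borel measurable with respect to the Borel σ-algebra of the Hausdorff distance on 𝒦'(ℂⁿ). -/
open TopologicalSpace MvPolynomial

theorem isOpen_setOf_sSup_norm_eval_lt {n : ℕ} (p : MvPolynomial (Fin n) ℂ) :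
    IsOpen {x : NonemptyCompacts (Fin n → ℂ) × (Fin n → ℂ) |
      sSup ((fun y => ‖eval y p‖) '' (x.1 : Set (Fin n → ℂ))) < ‖eval x.2 p‖} := by
  have hp : Continuous fun y : Fin n → ℂ => ‖eval y p‖ := (continuous_eval p).norm
  have h : {x : NonemptyCompacts (Fin n → ℂ) × (Fin n → ℂ) |
      sSup ((fun y => ‖eval y p‖) '' (x.1 : Set (Fin n → ℂ))) < ‖eval x.2 p‖} =
      ⋃ c : ℝ, {K : NonemptyCompacts (Fin n → ℂ) |
        (K : Set (Fin n → ℂ)) ⊆ {y | ‖eval y p‖ < c}} ×ˢ {z | c < ‖eval z p‖} := by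
    ext ⟨K, z⟩
    simp only [Set.mem_ofPred_eq, Set.mem_iUnion, Set.mem_prod]
    have himage := K.isCompact.image hp
    constructor
    · intro h
      obtain ⟨c, hKc, hcz⟩ := exists_between h
      exact ⟨c, fun y hy =>
        (le_csSup himage.bddAbove (Set.mem_image_of_mem _ hy)).trans_lt hKc, hcz⟩
    · rintro ⟨c, hKc, hcz⟩
      obtain ⟨y, hy, hymax⟩ := himage.sSup_mem (K.nonempty.image _)
      rw [← hymax]
      exact lt_trans (hKc hy) hcz
  rw [h]
  exact isOpen_iUnion fun c =>
    (NonemptyCompacts.isOpen_subsets_of_isOpen (isOpen_lt hp continuous_const)).prod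
      (isOpen_lt continuous_const hp)

theorem isClosed_setOf_mem_polyHull {n : ℕ} :
    IsClosed {x : NonemptyCompacts (Fin n → ℂ) × (Fin n → ℂ) |
      x.2 ∈ polyHull (x.1 : Set (Fin n → ℂ))} := by
  convert isClosed_iInter fun p : MvPolynomial (Fin n) ℂ =>
    (isOpen_setOf_sSup_norm_eval_lt p).isClosed_compl using 1
  ext x
  simp [polyHull]

theorem isClosed_setOf_polyHull_inter_nonempty {n : ℕ} {C : Set (Fin n → ℂ)}
    (hC : IsCompact C) :
    IsClosed {K : NonemptyCompacts (Fin n → ℂ) |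
      (polyHull (K : Set (Fin n → ℂ)) ∩ C).Nonempty} := by
  have := isCompact_iff_compactSpace.mp hC
  have h : IsClosed {x : NonemptyCompacts (Fin n → ℂ) × C |
      (x.2 : Fin n → ℂ) ∈ polyHull (x.1 : Set (Fin n → ℂ))} :=
    isClosed_setOf_mem_polyHull.preimage
      (continuous_fst.prodMk (continuous_subtype_val.comp continuous_snd))
  convert isClosedMap_fst_of_compactSpace _ h using 1
  ext K
  simp [Set.Nonempty, and_comm]

theorem measurableSet_setOf_polyHull_inter_nonempty {n : ℕ} {S : Set (Fin n → ℂ)}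
    (hS : IsSigmaCompact S) :
    MeasurableSet {K : NonemptyCompacts (Fin n → ℂ) |
      (polyHull (K : Set (Fin n → ℂ)) ∩ S).Nonempty} := by
  have : BorelSpace (NonemptyCompacts (Fin n → ℂ)) := ⟨rfl⟩
  obtain ⟨C, hC, rfl⟩ := hS
  simp only [Set.inter_iUnion, Set.nonempty_iUnion, Set.ofPred_exists]
  exact .iUnion fun k => (isClosed_setOf_polyHull_inter_nonempty (hC k)).measurableSet

theorem IsClosed.isSigmaCompact {X : Type*} [TopologicalSpace X] [SigmaCompactSpace X]
    {S : Set X} (hS : IsClosed S) : IsSigmaCompact S :=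
  isSigmaCompact_univ.of_isClosed_subset hS (Set.subset_univ S)

theorem IsOpen.isSigmaCompact {X : Type*} [PseudoEMetricSpace X] [SigmaCompactSpace X]
    {U : Set X} (hU : IsOpen U) : IsSigmaCompact U := by
  obtain ⟨F, hF, -, rfl, -⟩ := hU.exists_iUnion_isClosed
  exact isSigmaCompact_iUnion _ fun k => (hF k).isSigmaCompact

theorem TopologicalSpace.NonemptyCompacts.topology_eq_generateFrom
    {X : Type*} [TopologicalSpace X] :
    NonemptyCompacts.topology (α := X) = generateFrom
      ((fun U : Set X => {K : NonemptyCompacts X | (K : Set X) ⊆ U}) '' {U | IsOpen U} ∪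
        (fun U : Set X => {K : NonemptyCompacts X | ((K : Set X) ∩ U).Nonempty}) ''
          {U | IsOpen U}) := by
  refine induced_generateFrom_eq.trans ?_
  rw [Set.image_union, Set.image_image, Set.image_image]
  rfl

/-- **Measurability of the polynomially convex hull map.** The map
`𝒦'(ℂⁿ) → 𝒦'(ℂⁿ)` sending a nonempty compact set `K` to its polynomially
convex hull `K^` is Borel measurable with respect to the Hausdorff-distance
Borel σ-algebra. -/
theorem polyHull_map_measurable {n : ℕ}
    (T : NonemptyCompacts (Fin n → ℂ) → NonemptyCompacts (Fin n → ℂ))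
    (hT : ∀ Q : NonemptyCompacts (Fin n → ℂ),
      (T Q : Set (Fin n → ℂ)) = polyHull (Q : Set (Fin n → ℂ))) :
    Measurable T := by
  have hborel := borel_eq_generateFrom_of_subbasis
    (NonemptyCompacts.topology_eq_generateFrom (X := Fin n → ℂ))
  refine Measurable.mono (measurable_generateFrom ?_) le_rfl hborel.le
  rintro _ (⟨U, hU, rfl⟩ | ⟨U, hU, rfl⟩)
  · have hU : IsOpen U := hU
    convert (measurableSet_setOf_polyHull_inter_nonempty
      hU.isClosed_compl.isSigmaCompact).compl using 1
    ext K
    simp [hT, Set.inter_compl_nonempty_iff]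
  · simpa [hT] using measurableSet_setOf_polyHull_inter_nonempty (IsOpen.isSigmaCompact hU)
end

section
/- Let (Ω, 𝒜) be a measurable space and K : Ω → 𝒦'(ℂⁿ) a random compact set. For a nonempty compact set E ⊆ ℂⁿ, define the Siciak extremal function Φ_E(z) = sup{|p(z)|^{1/deg p} : p a polynomial in n complex variables with deg p ≥ 1 and max_{x∈E} |p(x)| ≤ 1}, with values in [0, ∞]. Then for every z ∈ ℂⁿ, the functions ω ↦ Φ_{K(ω)}(z) and ω ↦ log Φ_{K(ω)}(z) (the pluricomplex Green function V_{K(ω)}(z)) are measurable as maps from Ω to ℝ ∪ {∞} (with the Borel σ-algebra). -/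
open TopologicalSpace MvPolynomial

/-- The Siciak extremal function of a set `E ⊆ ℂⁿ`, with values in `[0, ∞]`:
`Φ_E(z) = sup { |p z|^(1/deg p) : p polynomial, deg p ≥ 1, sup_{x∈E} |p x| ≤ 1 }`. -/
noncomputable def siciak {n : ℕ} (E : Set (Fin n → ℂ)) (z : Fin n → ℂ) :
    ENNReal :=
  ⨆ p : {p : MvPolynomial (Fin n) ℂ //
      1 ≤ p.totalDegree ∧ ∀ x ∈ E, ‖eval x p‖ ≤ 1},
    ENNReal.ofReal (‖eval z p.1‖ ^ (((p.1.totalDegree : ℝ))⁻¹))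

/-- For a fixed point `z`, the Siciak extremal function is lower semicontinuous as a function of
the compact set: every competing polynomial, shrunk by a factor `t < 1`, still competes for all
nearby compact sets. -/
theorem lowerSemicontinuous_siciak {n : ℕ} (z : Fin n → ℂ) :
    LowerSemicontinuous (fun E : NonemptyCompacts (Fin n → ℂ) =>
      siciak (E : Set (Fin n → ℂ)) z) := by
  intro E c hc
  obtain ⟨⟨p, hp, hpE⟩, hcp⟩ := lt_iSup_iff.1 hc
  have hcont : Continuous fun t : ℝ =>
      ENNReal.ofReal ((t * ‖eval z p‖) ^ ((p.totalDegree : ℝ)⁻¹)) :=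
    ENNReal.continuous_ofReal.comp
      ((continuous_id.mul continuous_const).rpow_const fun _ => Or.inr (by positivity))
  have hev : ∀ᶠ t in nhdsWithin (1 : ℝ) (Set.Iio 1),
      c < ENNReal.ofReal ((t * ‖eval z p‖) ^ ((p.totalDegree : ℝ)⁻¹)) :=
    (hcont.continuousAt.eventually_const_lt (by simpa using hcp)).filter_mono nhdsWithin_le_nhds
  obtain ⟨t, hct, ht0, ht1⟩ := (hev.and (Ioo_mem_nhdsLT zero_lt_one)).exists
  have hdeg : (C (t : ℂ) * p).totalDegree = p.totalDegree := by
    have ht : (t : ℂ) ≠ 0 := by exact_mod_cast ht0.ne'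
    have hp0 : p ≠ 0 := by
      rintro rfl
      simp at hp
    rw [totalDegree_mul_of_isDomain (by simpa using ht) hp0, totalDegree_C, zero_add]
  have hnorm (x : Fin n → ℂ) : ‖eval x (C (t : ℂ) * p)‖ = t * ‖eval x p‖ := by
    simp [abs_of_pos ht0]
  have hopen : IsOpen {x : Fin n → ℂ | t * ‖eval x p‖ < 1} :=
    isOpen_lt (continuous_const.mul p.continuous_eval.norm) continuous_const
  have hsub : (E : Set (Fin n → ℂ)) ⊆ {x | t * ‖eval x p‖ < 1} := fun x hx =>
    (mul_le_of_le_one_right ht0.le (hpE x hx)).trans_lt ht1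
  filter_upwards [(NonemptyCompacts.isOpen_subsets_of_isOpen hopen).mem_nhds hsub] with F hF
  refine hct.trans_le ?_
  have hle := le_iSup (fun q : {p : MvPolynomial (Fin n) ℂ //
      1 ≤ p.totalDegree ∧ ∀ x ∈ (F : Set (Fin n → ℂ)), ‖eval x p‖ ≤ 1} =>
    ENNReal.ofReal (‖eval z q.1‖ ^ ((q.1.totalDegree : ℝ)⁻¹)))
    ⟨C (t : ℂ) * p, hdeg.symm ▸ hp, fun x hx => (hnorm x).trans_le (hF hx).le⟩
  simpa only [siciak, hnorm, hdeg] using hle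

/-- **The Siciak extremal function and the pluricomplex Green function of a
random compact set are random functions.** If `K : Ω → 𝒦'(ℂⁿ)` is a random
compact set, then for every `z ∈ ℂⁿ` the maps `ω ↦ Φ_{K ω}(z)` and
`ω ↦ log Φ_{K ω}(z) = V_{K ω}(z)` are measurable. -/
theorem siciak_random
    {Ω : Type*} [MeasurableSpace Ω] {n : ℕ}
    (K : Ω → NonemptyCompacts (Fin n → ℂ)) (hK : Measurable K)
    (z : Fin n → ℂ) :
    Measurable (fun ω => siciak (K ω : Set (Fin n → ℂ)) z) ∧
    Measurable (fun ω => ENNReal.log (siciak (K ω : Set (Fin n → ℂ)) z)) := by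
  have : BorelSpace (NonemptyCompacts (Fin n → ℂ)) := ⟨rfl⟩
  have h := (lowerSemicontinuous_siciak z).measurable.comp hK
  exact ⟨h, h.ennreal_log⟩
end

section
/- Let (Ω, 𝒜) be a measurable space and K : Ω → 𝒦'(ℂⁿ) a uniformly separable random compact set, i.e. there is a countable set E ⊆ ℂⁿ with E ∩ K(ω) dense in K(ω) for every ω. Let f and f_j (j ∈ ℕ) be generalized random functions on the graph Gr K = {(ω, z) : z ∈ K(ω)} such that each f_j(ω, ·) and f(ω, ·) is continuous on K(ω), and suppose that for every ω ∈ Ω, f_j(ω, ·) → f(ω, ·) uniformly on K(ω). Then there exists a sequence (F_j) of generalized random functions on Gr K, each continuous in the second variable, such that F_j → f uniformly on Gr K (i.e. sup_{(ω,z)∈Gr K} |F_j(ω,z) − f(ω,z)| → 0), and for every ω ∈ Ω and j ∈ ℕ there exists k ∈ ℕ with F_j(ω, ·) = f_k(ω, ·) on K(ω). -/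
open TopologicalSpace Filter

/-- A generalized random function on the graph of a random compact set
`K : Ω → 𝒦'(ℂⁿ)`: for every `z`, the map `ω ↦ g ω z` is measurable on
`K⁻¹(z) = {ω : z ∈ K ω}` (with the subspace σ-algebra). -/
def GenRandom {Ω : Type*} [MeasurableSpace Ω] {n : ℕ}
    (K : Ω → NonemptyCompacts (Fin n → ℂ))
    (g : Ω → (Fin n → ℂ) → ℂ) : Prop :=
  ∀ z : Fin n → ℂ,
    Measurable fun ω : {ω : Ω // z ∈ (K ω : Set (Fin n → ℂ))} => g ω.1 z

theorem measurableSet_mem_nonemptyCompacts {X Ω : Type*} [MetricSpace X] [MeasurableSpace Ω]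
    {K : Ω → NonemptyCompacts X} (hK : Measurable K) (z : X) :
    MeasurableSet {ω | z ∈ (K ω : Set X)} := by
  have : BorelSpace (NonemptyCompacts X) := ⟨rfl⟩
  have h : IsOpen {C : NonemptyCompacts X | (C : Set X) ⊆ {z}ᶜ} :=
    NonemptyCompacts.isOpen_subsets_of_isOpen isOpen_compl_singleton
  convert (hK h.measurableSet).compl using 1
  ext ω
  simp

theorem GenRandom.measurableSet_norm_sub_le {Ω : Type*} [MeasurableSpace Ω] {n : ℕ}
    {K : Ω → NonemptyCompacts (Fin n → ℂ)} (hK : Measurable K)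
    {g h : Ω → (Fin n → ℂ) → ℂ} (hg : GenRandom K g) (hh : GenRandom K h)
    (ε : ℝ) (z : Fin n → ℂ) :
    MeasurableSet {ω | z ∈ (K ω : Set (Fin n → ℂ)) → ‖g ω z - h ω z‖ ≤ ε} := by
  have hz := measurableSet_mem_nonemptyCompacts hK z
  have hle : MeasurableSet {ω : {ω : Ω // z ∈ (K ω : Set (Fin n → ℂ))} |
      ‖g ω.1 z - h ω.1 z‖ ≤ ε} :=
    measurableSet_le ((hg z).sub (hh z)).norm measurable_const
  convert hz.compl.union (hz.subtype_image hle) using 1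
  ext ω
  by_cases hω : z ∈ (K ω : Set (Fin n → ℂ)) <;> simp_all

theorem ContinuousOn.norm_sub_le_of_dense {X : Type*} [TopologicalSpace X] {s E : Set X}
    {g h : X → ℂ} (hg : ContinuousOn g s) (hh : ContinuousOn h s)
    (hE : s ⊆ closure (E ∩ s)) {ε : ℝ} (hle : ∀ z ∈ E, z ∈ s → ‖g z - h z‖ ≤ ε) :
    ∀ z ∈ s, ‖g z - h z‖ ≤ ε := by
  intro z hz
  have : (nhdsWithin z (E ∩ s)).NeBot := mem_closure_iff_nhdsWithin_neBot.mp (hE hz)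
  refine le_of_tendsto (x := nhdsWithin z (E ∩ s)) ((((hg.sub hh).norm) z hz).mono_left
    (nhdsWithin_mono z Set.inter_subset_right)) ?_
  filter_upwards [self_mem_nhdsWithin] with w hw using hle w hw.1 hw.2

/-- **From pointwise-uniform to jointly uniform convergence.** Let `K` be a
uniformly separable random compact set, `f` and `fseq j` generalized random
functions on `Gr K`, continuous on `K ω` for each `ω`, with
`fseq j (ω, ·) → f(ω, ·)` uniformly on `K ω` for every `ω`.  Then there is a
sequence `F j` of generalized random functions on `Gr K`, continuous in the
second variable, with `F j → f` uniformly on the graph of `K`, and such that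
for all `ω` and `j`, `F j (ω, ·)` agrees with some `fseq k (ω, ·)` on `K ω`. -/
theorem uniform_convergence_extraction
    {Ω : Type*} [MeasurableSpace Ω] {n : ℕ}
    (K : Ω → NonemptyCompacts (Fin n → ℂ)) (hK : Measurable K)
    (hsep : ∃ E : Set (Fin n → ℂ), E.Countable ∧
      ∀ ω, (K ω : Set (Fin n → ℂ)) ⊆ closure (E ∩ (K ω : Set (Fin n → ℂ))))
    (f : Ω → (Fin n → ℂ) → ℂ) (fseq : ℕ → Ω → (Fin n → ℂ) → ℂ)
    (hf_rand : GenRandom K f) (hfseq_rand : ∀ j, GenRandom K (fseq j))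
    (hf_cont : ∀ ω, ContinuousOn (f ω) (K ω : Set (Fin n → ℂ)))
    (hfseq_cont : ∀ j ω, ContinuousOn (fseq j ω) (K ω : Set (Fin n → ℂ)))
    (hconv : ∀ ω, TendstoUniformlyOn (fun j => fseq j ω) (f ω) atTop
      (K ω : Set (Fin n → ℂ))) :
    ∃ F : ℕ → Ω → (Fin n → ℂ) → ℂ,
      (∀ j, GenRandom K (F j)) ∧
      (∀ j ω, ContinuousOn (F j ω) (K ω : Set (Fin n → ℂ))) ∧
      (∀ ε > (0:ℝ), ∃ N : ℕ, ∀ j ≥ N, ∀ ω,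
        ∀ z ∈ (K ω : Set (Fin n → ℂ)), ‖F j ω z - f ω z‖ < ε) ∧
      (∀ ω j, ∃ k : ℕ, ∀ z ∈ (K ω : Set (Fin n → ℂ)),
        F j ω z = fseq k ω z) := by
  classical
  obtain ⟨E, hE, hdense⟩ := hsep
  let p : ℕ → ℕ → Ω → Prop := fun j k ω =>
    ∀ z ∈ E, z ∈ (K ω : Set (Fin n → ℂ)) → ‖fseq k ω z - f ω z‖ ≤ 1 / ((j : ℝ) + 1)
  have hp_meas : ∀ j k, MeasurableSet {ω | p j k ω} := fun j k => by
    have h := MeasurableSet.biInter hE fun z _ =>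
      (hfseq_rand k).measurableSet_norm_sub_le hK hf_rand (1 / ((j : ℝ) + 1)) z
    convert h using 1
    ext ω
    simp [p]
  have hp_ex : ∀ j ω, ∃ k, p j k ω := fun j ω => by
    obtain ⟨k, hk⟩ := (Metric.tendstoUniformlyOn_iff.mp (hconv ω) (1 / ((j : ℝ) + 1))
      Nat.one_div_pos_of_nat).exists
    refine ⟨k, fun z _ hz => ?_⟩
    rw [← dist_eq_norm, dist_comm]
    exact (hk z hz).le
  refine ⟨fun j ω => fseq (Nat.find (hp_ex j ω)) ω, fun j z => ?_,
    fun j ω => hfseq_cont _ ω, fun ε hε => ?_, fun ω j => ⟨_, fun z _ => rfl⟩⟩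
  · exact Measurable.find
      (f := fun k (ω : {ω : Ω // z ∈ (K ω : Set (Fin n → ℂ))}) => fseq k ω.1 z)
      (p := fun k ω => p j k ω.1) (fun k => hfseq_rand k z)
      (fun k => measurable_subtype_coe (hp_meas j k)) (fun ω => hp_ex j ω.1)
  · obtain ⟨N, hN⟩ := exists_nat_one_div_lt hε
    refine ⟨N, fun j hj ω z hz => ?_⟩
    calc _ ≤ 1 / ((j : ℝ) + 1) :=
          (hfseq_cont _ ω).norm_sub_le_of_dense (hf_cont ω) (hdense ω)
            (Nat.find_spec (hp_ex j ω)) z hz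
      _ ≤ 1 / ((N : ℝ) + 1) := Nat.one_div_le_one_div hj
      _ < ε := hN
end

section
/- Let (Ω, 𝒜) be a measurable space and K : Ω → 𝒦'(ℂⁿ) a random compact set. (i) If K takes at most countably many values, then K is uniformly separable. (ii) If the set ⋃_{ω∈Ω} (K(ω) \ closure(interior K(ω))) is countable, then K is uniformly separable. (iii) In particular, if K(ω) is the closure of a bounded open subset of ℂⁿ for every ω ∈ Ω, then K is uniformly separable. -/
open TopologicalSpace

/-- A random compact set `K : Ω → 𝒦'(ℂⁿ)` is uniformly separable if there is
a countable set `E ⊆ ℂⁿ` with `E ∩ K ω` dense in `K ω` for every `ω`. -/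
def UniformlySeparable {Ω : Type*} {n : ℕ}
    (K : Ω → NonemptyCompacts (Fin n → ℂ)) : Prop :=
  ∃ E : Set (Fin n → ℂ), E.Countable ∧
    ∀ ω, (K ω : Set (Fin n → ℂ)) ⊆ closure (E ∩ (K ω : Set (Fin n → ℂ)))

theorem UniformlySeparable.of_countable_range {Ω : Type*} {n : ℕ}
    {K : Ω → NonemptyCompacts (Fin n → ℂ)} (h : (Set.range K).Countable) :
    UniformlySeparable K := by
  have separable (L : NonemptyCompacts (Fin n → ℂ)) :
      ∃ t ⊆ (L : Set (Fin n → ℂ)), t.Countable ∧ (L : Set (Fin n → ℂ)) ⊆ closure t :=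
    (IsSeparable.of_separableSpace _).exists_countable_dense_subset
  choose D hD_subset hD_countable hD_dense using separable
  refine ⟨⋃ L ∈ Set.range K, D L, h.biUnion fun L _ => hD_countable L, fun ω => ?_⟩
  exact (hD_dense (K ω)).trans <| closure_mono <|
    Set.subset_inter (Set.subset_biUnion_of_mem (Set.mem_range_self ω)) (hD_subset (K ω))

theorem UniformlySeparable.of_countable_diff_closure_interior {Ω : Type*} {n : ℕ}
    {K : Ω → NonemptyCompacts (Fin n → ℂ)}
    (h : (⋃ ω, ((K ω : Set (Fin n → ℂ)) \
      closure (interior (K ω : Set (Fin n → ℂ))))).Countable) :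
    UniformlySeparable K := by
  obtain ⟨D, hD_countable, hD_dense⟩ := exists_countable_dense (Fin n → ℂ)
  refine ⟨_, hD_countable.union h, fun ω x hx => ?_⟩
  by_cases hxi : x ∈ closure (interior (K ω : Set (Fin n → ℂ)))
  · have hsub : interior (K ω : Set (Fin n → ℂ)) ⊆
        closure (D ∩ interior (K ω : Set (Fin n → ℂ))) := by
      rw [Set.inter_comm]
      exact hD_dense.open_subset_closure_inter isOpen_interior
    exact closure_mono (Set.inter_subset_inter Set.subset_union_left interior_subset)
      (closure_minimal hsub isClosed_closure hxi)
  · exact subset_closure ⟨Or.inr (Set.mem_iUnion.2 ⟨ω, hx, hxi⟩), hx⟩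

/-- **Sufficient conditions for uniform separability.** Let `K` be a random
compact set in `ℂⁿ`. (i) If `K` takes at most countably many values, then
`K` is uniformly separable. (ii) If `⋃_ω (K ω \ closure (interior (K ω)))`
is countable, then `K` is uniformly separable. (iii) If each `K ω` is the
closure of a bounded open subset of `ℂⁿ`, then `K` is uniformly separable. -/
theorem uniformlySeparable_sufficient_conditions
    {Ω : Type*} [MeasurableSpace Ω] {n : ℕ}
    (K : Ω → NonemptyCompacts (Fin n → ℂ)) (hK : Measurable K) :
    ((Set.range K).Countable → UniformlySeparable K) ∧
    ((⋃ ω, ((K ω : Set (Fin n → ℂ)) \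
        closure (interior (K ω : Set (Fin n → ℂ))))).Countable →
      UniformlySeparable K) ∧
    ((∀ ω, ∃ V : Set (Fin n → ℂ), IsOpen V ∧ Bornology.IsBounded V ∧
        (K ω : Set (Fin n → ℂ)) = closure V) →
      UniformlySeparable K) := by
  refine ⟨.of_countable_range, .of_countable_diff_closure_interior, fun h =>
    .of_countable_diff_closure_interior ?_⟩
  have hempty (ω : Ω) : (K ω : Set (Fin n → ℂ)) \
      closure (interior (K ω : Set (Fin n → ℂ))) = ∅ := by
    obtain ⟨V, hV, -, hKV⟩ := h ω
    rw [Set.sdiff_eq_empty, hKV]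
    exact closure_mono (interior_maximal subset_closure hV)
  simp [hempty]
end

section
/- Let (Ω, 𝒜, μ) be a σ-finite measure space and K : Ω → 𝒦'(ℂⁿ) a random compact set taking at most countably many distinct values, and suppose each K(ω) is polynomially convex, i.e. K(ω) = \hat{K(ω)} for all ω. Let ε : Ω → (0, ∞) be measurable, and let f be a generalized random function on Gr K = {(ω, z) : z ∈ K(ω)} such that for every ω there exist an open set V ⊇ K(ω) and a holomorphic function g on V with g = f(ω, ·) on K(ω). Then there exists a function p : Ω × ℂⁿ → ℂ such that p(ω, ·) is a polynomial for every ω, p(·, z) restricted to K⁻¹(z) is measurable for every z ∈ ℂⁿ, and max_{z∈K(ω)} |p(ω, z) − f(ω, z)| < ε(ω) for all ω outside a set L ⊆ Ω with μ(L) = 0. -/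
open TopologicalSpace MvPolynomial MeasureTheory

section OkaWeil

open Filter Topology Set

/-- A complex differentiable function on an open subset of a finite-dimensional space is `C¹`. -/
lemma contDiffAt_one_of_differentiableOn {E : Type*} [NormedAddCommGroup E] [NormedSpace ℂ E]
    [ProperSpace E] {U : Set E} (hU : IsOpen U) {g : E → ℂ} (hg : DifferentiableOn ℂ g U)
    {x : E} (hx : x ∈ U) : ContDiffAt ℂ 1 g x := by
  rw [contDiffAt_one_iff]
  refine ⟨fderiv ℂ g, U, hU.mem_nhds hx, fun x hx => ContinuousAt.continuousWithinAt ?_,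
    fun y hy => (hg.differentiableAt (hU.mem_nhds hy)).hasFDerivAt⟩
  obtain ⟨r, hr, hrU⟩ : ∃ r > 0, Metric.closedBall x (2 * r) ⊆ U := by
    obtain ⟨r, hr, h⟩ := Metric.nhds_basis_closedBall.mem_iff.1 (hU.mem_nhds hx)
    exact ⟨r / 2, by positivity, by rwa [mul_div_cancel₀ _ (two_ne_zero)]⟩
  have huc : UniformContinuousOn g (Metric.closedBall x (2 * r)) :=
    (isCompact_closedBall x (2 * r)).uniformContinuousOn_of_continuous (hg.continuousOn.mono hrU)
  rw [Metric.continuousAt_iff]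
  intro ε hε
  obtain ⟨δ, hδ, H⟩ := Metric.uniformContinuousOn_iff.1 huc (ε / 2 * r) (by positivity)
  refine ⟨min δ r, lt_min hδ hr, fun y hy => ?_⟩
  have hyδ : dist y x < δ := hy.trans_le (min_le_left _ _)
  have hyr : dist y x < r := hy.trans_le (min_le_right _ _)
  refine lt_of_le_of_lt ?_ (half_lt_self hε)
  rw [dist_eq_norm]
  refine ContinuousLinearMap.opNorm_le_bound _ (by positivity) fun v => ?_
  rcases eq_or_ne v 0 with rfl | hv
  · simp
  have hv' : 0 < ‖v‖ := norm_pos_iff.2 hv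
  have hmem : ∀ w, dist w x < r → ∀ ζ ∈ Metric.closedBall (0 : ℂ) (r / ‖v‖),
      w + ζ • v ∈ Metric.closedBall x (2 * r) := by
    intro w hw ζ hζ
    rw [mem_closedBall_zero_iff, le_div_iff₀ hv', ← norm_smul] at hζ
    rw [Metric.mem_closedBall, dist_eq_norm, add_sub_right_comm]
    rw [dist_eq_norm] at hw
    linarith [norm_add_le (w - x) (ζ • v)]
  have hline : ∀ w, dist w x < r → ∀ ζ ∈ Metric.closedBall (0 : ℂ) (r / ‖v‖),
      HasDerivAt (fun ζ : ℂ => g (w + ζ • v)) (fderiv ℂ g (w + ζ • v) v) ζ := by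
    intro w hw ζ hζ
    have h1 : HasDerivAt (fun ζ : ℂ => w + ζ • v) v ζ := by
      simpa using ((hasDerivAt_id ζ).smul_const v).const_add w
    exact (hg.differentiableAt
      (hU.mem_nhds (hrU (hmem w hw ζ hζ)))).hasFDerivAt.comp_hasDerivAt ζ h1
  have h0 : (0 : ℂ) ∈ Metric.closedBall (0 : ℂ) (r / ‖v‖) := by
    simp; positivity
  have hxx : dist x x < r := by simpa using hr
  have hd : ∀ ζ ∈ Metric.closedBall (0 : ℂ) (r / ‖v‖),
      HasDerivAt (fun ζ : ℂ => g (y + ζ • v) - g (x + ζ • v))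
        (fderiv ℂ g (y + ζ • v) v - fderiv ℂ g (x + ζ • v) v) ζ :=
    fun ζ hζ => (hline y hyr ζ hζ).sub (hline x hxx ζ hζ)
  have hR : 0 < r / ‖v‖ := by positivity
  have hdc : DiffContOnCl ℂ (fun ζ : ℂ => g (y + ζ • v) - g (x + ζ • v))
      (Metric.ball 0 (r / ‖v‖)) := by
    refine DifferentiableOn.diffContOnCl fun ζ hζ => ?_
    rw [closure_ball _ hR.ne'] at hζ
    exact (hd ζ hζ).differentiableAt.differentiableWithinAt
  have key := Complex.norm_deriv_le_of_forall_mem_sphere_norm_le (C := ε / 2 * r) hR hdc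
    (fun ζ hζ => by
      have hζ' := Metric.sphere_subset_closedBall hζ
      rw [← dist_eq_norm]
      exact (H _ (hmem y hyr ζ hζ') _ (hmem x hxx ζ hζ') (by simpa using hyδ)).le)
  rw [(hd 0 h0).deriv] at key
  simp only [zero_smul, add_zero] at key
  calc _ ≤ _ := key
    _ = ε / 2 * ‖v‖ := by field_simp

/-- Holomorphic dependence on parameters of an integral along a path. -/
lemma contDiffAt_one_pathIntegral {E : Type*} [NormedAddCommGroup E] [NormedSpace ℂ E]
    [ProperSpace E] {Ψ : ℂ × E → ℂ} {γ : ℝ → ℂ} (hγ : Continuous γ) {a b : ℝ} {x : E}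
    (h : ∀ t ∈ uIcc a b, ContDiffAt ℂ 1 Ψ (γ t, x)) :
    ContDiffAt ℂ 1 (fun z => ∫ t in a..b, Ψ (γ t, z)) x := by
  have hopen : ∀ z : E, (∀ t ∈ uIcc a b, ContDiffAt ℂ 1 Ψ (γ t, z)) →
      ∀ᶠ w in 𝓝 z, ∀ t ∈ uIcc a b, ContDiffAt ℂ 1 Ψ (γ t, w) := by
    intro z hz
    refine isCompact_uIcc.eventually_forall_of_forall_eventually fun t ht => ?_
    have h1 := (hz t ht).eventually (by simp)
    have h2 : Tendsto (fun q : E × ℝ => (γ q.2, q.1)) (𝓝 (z, t)) (𝓝 (γ t, z)) :=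
      Continuous.tendsto (by fun_prop) _
    exact h2.eventually h1
  set V : Set E := {z | ∀ t ∈ uIcc a b, ContDiffAt ℂ 1 Ψ (γ t, z)} with hV
  have hVo : IsOpen V := isOpen_iff_mem_nhds.2 fun z hz => hopen z hz
  refine contDiffAt_one_of_differentiableOn hVo (fun z hz => ?_) h
  apply DifferentiableAt.differentiableWithinAt
  obtain ⟨r, hr, hrV⟩ := Metric.nhds_basis_closedBall.mem_iff.1 (hVo.mem_nhds hz)
  have hcontΨ : ∀ w ∈ V, ContinuousOn (fun t => Ψ (γ t, w)) (uIcc a b) := fun w hw t ht =>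
    ((hw t ht).continuousAt.comp (f := fun t => (γ t, w))
      (Continuous.continuousAt (by fun_prop))).continuousWithinAt
  have hcont' : ContinuousOn (fun q : ℝ × E => (fderiv ℂ Ψ (γ q.1, q.2)).comp
      (ContinuousLinearMap.inr ℂ ℂ E)) (uIcc a b ×ˢ Metric.closedBall z r) := by
    rintro ⟨t, w⟩ ⟨ht, hw⟩
    have h1 : ContinuousAt (fderiv ℂ Ψ) (γ t, w) :=
      ((hrV hw t ht).fderiv_right (m := 0) (by simp)).continuousAt
    have h2 : ContinuousAt (fun q : ℝ × E => fderiv ℂ Ψ (γ q.1, q.2)) (t, w) :=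
      h1.comp (f := fun q : ℝ × E => (γ q.1, q.2)) (Continuous.continuousAt (by fun_prop))
    exact (h2.clm_comp continuousAt_const).continuousWithinAt
  obtain ⟨C, hC⟩ := (isCompact_uIcc.prod (isCompact_closedBall z r)).exists_bound_of_continuousOn
    hcont'
  refine (intervalIntegral.hasFDerivAt_integral_of_dominated_of_fderiv_le (𝕜 := ℂ) (μ := volume)
    (F := fun z t => Ψ (γ t, z))
    (F' := fun z t => (fderiv ℂ Ψ (γ t, z)).comp (ContinuousLinearMap.inr ℂ ℂ E))
    (bound := fun _ => C) (Metric.closedBall_mem_nhds z hr) ?_ ?_ ?_ ?_ ?_ ?_).differentiableAt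
  · filter_upwards [hVo.mem_nhds hz] with w hw
    exact ((hcontΨ w hw).mono uIoc_subset_uIcc).aestronglyMeasurable measurableSet_uIoc
  · exact (hcontΨ z hz).intervalIntegrable
  · have : ContinuousOn (fun t => (fderiv ℂ Ψ (γ t, z)).comp (ContinuousLinearMap.inr ℂ ℂ E))
        (uIcc a b) :=
      hcont'.comp (f := fun t => (t, z)) (by fun_prop)
        fun t ht => ⟨ht, Metric.mem_closedBall_self hr.le⟩
    exact (this.mono uIoc_subset_uIcc).aestronglyMeasurable measurableSet_uIoc
  · exact Eventually.of_forall fun t ht w hw => hC (t, w) ⟨uIoc_subset_uIcc ht, hw⟩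
  · exact intervalIntegrable_const
  · refine Eventually.of_forall fun t ht w hw => ?_
    have h1 := ((hrV hw t (uIoc_subset_uIcc ht)).differentiableAt (by simp)).hasFDerivAt
    exact h1.comp w (hasFDerivAt_prodMk_right (γ t) w)

open Complex in
lemma log_I_mul_sub_log {u : ℂ} (hu : 0 < u.re) : log (I * u) - log u = Real.pi / 2 * I := by
  have h0 : u ≠ 0 := by rintro rfl; simp at hu
  have h1 := abs_lt.1 (Complex.abs_arg_lt_pi_div_two_iff.2 (Or.inl hu))
  rw [Complex.log_mul I_ne_zero h0, log_I]
  · ring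
  · rw [arg_I]; constructor <;> linarith [h1.1, h1.2, Real.pi_pos]

open Complex in
/-- The integral of `1 / (ζ - z₀)` along a segment which, after a rotation by `c` about `z₀`, lies
in the right half-plane. -/
lemma integral_inv_segment {p d c z₀ : ℂ} (hc : c ≠ 0) {a b : ℝ}
    (h : ∀ t : ℝ, 0 < (c * (p + t * d - z₀)).re) :
    (∫ t in a..b, d / (p + t * d - z₀)) =
      log (c * (p + b * d - z₀)) - log (c * (p + a * d - z₀)) := by
  have hne : ∀ t : ℝ, p + t * d - z₀ ≠ 0 := fun t h0 => by simpa [h0] using h t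
  refine intervalIntegral.integral_eq_sub_of_hasDerivAt
    (f := fun t : ℝ => log (c * (p + t * d - z₀))) (fun t _ => ?_) ?_
  · have h1 : HasDerivAt (fun t : ℝ => c * (p + t * d - z₀)) (c * d) t := by
      simpa using (((ofRealCLM.hasDerivAt (x := t)).mul_const d).const_add p |>.sub_const z₀
        |>.const_mul c)
    have h2 := h1.clog_real (Or.inl (h t))
    rwa [mul_div_mul_left _ _ hc] at h2
  · refine ContinuousOn.intervalIntegrable fun t _ => ContinuousAt.continuousWithinAt ?_
    exact ContinuousAt.div (by fun_prop) (Continuous.continuousAt (by fun_prop)) (hne t)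

open Complex in
/-- The winding number of the boundary of a rectangle about an interior point. -/
lemma integral_boundary_rect_inv {z₀ : ℂ} {r₁ r₂ q₁ q₂ : ℝ} (hr₁ : r₁ < z₀.re) (hr₂ : z₀.re < r₂)
    (hq₁ : q₁ < z₀.im) (hq₂ : z₀.im < q₂) :
    (∫ t : ℝ in r₁..r₂, 1 / (t + q₁ * I - z₀)) - (∫ t : ℝ in r₁..r₂, 1 / (t + q₂ * I - z₀)) +
      I * (∫ t : ℝ in q₁..q₂, 1 / (r₂ + t * I - z₀)) -
      I * (∫ t : ℝ in q₁..q₂, 1 / (r₁ + t * I - z₀)) = 2 * Real.pi * I := by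
  have hbot := integral_inv_segment (p := q₁ * I) (d := 1) (c := I) (z₀ := z₀) I_ne_zero
    (a := r₁) (b := r₂) (by intro t; simp; linarith)
  have htop := integral_inv_segment (p := q₂ * I) (d := 1) (c := -I) (z₀ := z₀)
    (neg_ne_zero.2 I_ne_zero) (a := r₁) (b := r₂) (by intro t; simp; linarith)
  have hright := integral_inv_segment (p := r₂) (d := I) (c := 1) (z₀ := z₀) one_ne_zero
    (a := q₁) (b := q₂) (by intro t; simp; linarith)
  have hleft := integral_inv_segment (p := r₁) (d := I) (c := -1) (z₀ := z₀) (by simp)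
    (a := q₁) (b := q₂) (by intro t; simp; linarith)
  have c₁ := log_I_mul_sub_log (u := r₂ + q₁ * I - z₀) (by simp; linarith)
  have c₂ := log_I_mul_sub_log (u := -I * (r₂ + q₂ * I - z₀)) (by simp; linarith)
  have c₃ := log_I_mul_sub_log (u := -(r₁ + q₂ * I - z₀)) (by simp; linarith)
  have c₄ := log_I_mul_sub_log (u := I * (r₁ + q₁ * I - z₀)) (by simp; linarith)
  have e : ∀ w : ℂ, I * (-I * w) = w := fun w => by linear_combination -w * I_mul_I
  have e' : ∀ w : ℂ, I * (I * w) = -w := fun w => by linear_combination w * I_mul_I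
  have e'' : ∀ w : ℂ, I * -w = -I * w := fun w => by ring
  rw [e] at c₂
  rw [e''] at c₃
  rw [e'] at c₄
  have s : ∀ (a b c : ℝ), I * (∫ t : ℝ in a..b, 1 / (c + t * I - z₀)) =
      ∫ t : ℝ in a..b, I / (c + t * I - z₀) := fun a b c => by
    rw [← intervalIntegral.integral_const_mul]; simp [div_eq_mul_inv]
  have s' : ∀ (a b c : ℝ), (∫ t : ℝ in a..b, 1 / (t + c * I - z₀)) =
      ∫ t : ℝ in a..b, 1 / (c * I + t * 1 - z₀) := fun a b c => by
    simp only [mul_one, add_comm]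
  rw [s, s, s', s', hbot, htop, hright, hleft]
  simp only [mul_one, one_mul, neg_mul, add_comm] at *
  linear_combination c₁ + c₂ + c₃ + c₄

open Complex in
/-- The Cauchy integral formula on a rectangle. -/
lemma integral_boundary_rect_div_sub {g : ℂ → ℂ} {z₀ : ℂ} {r₁ r₂ q₁ q₂ : ℝ}
    (hr₁ : r₁ < z₀.re) (hr₂ : z₀.re < r₂) (hq₁ : q₁ < z₀.im) (hq₂ : z₀.im < q₂)
    (hg : DifferentiableOn ℂ g (Icc r₁ r₂ ×ℂ Icc q₁ q₂)) :
    (∫ t : ℝ in r₁..r₂, g (t + q₁ * I) / (t + q₁ * I - z₀)) -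
      (∫ t : ℝ in r₁..r₂, g (t + q₂ * I) / (t + q₂ * I - z₀)) +
      I * (∫ t : ℝ in q₁..q₂, g (r₂ + t * I) / (r₂ + t * I - z₀)) -
      I * (∫ t : ℝ in q₁..q₂, g (r₁ + t * I) / (r₁ + t * I - z₀)) = 2 * Real.pi * I * g z₀ := by
  have hr : r₁ ≤ r₂ := by linarith
  have hq : q₁ ≤ q₂ := by linarith
  have hnhds : Icc r₁ r₂ ×ℂ Icc q₁ q₂ ∈ 𝓝 z₀ := by
    refine mem_of_superset ((isOpen_Ioo.reProdIm isOpen_Ioo).mem_nhds (x := z₀)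
      (s := Ioo r₁ r₂ ×ℂ Ioo q₁ q₂) ⟨⟨hr₁, hr₂⟩, hq₁, hq₂⟩) ?_
    exact fun z hz => ⟨Ioo_subset_Icc_self hz.1, Ioo_subset_Icc_self hz.2⟩
  have h0 := integral_boundary_rect_eq_zero_of_differentiableOn (dslope g z₀) ⟨r₁, q₁⟩ ⟨r₂, q₂⟩
    (by simpa only [uIcc_of_le hr, uIcc_of_le hq] using (differentiableOn_dslope hnhds).2 hg)
  simp only [smul_eq_mul] at h0
  have hw := integral_boundary_rect_inv hr₁ hr₂ hq₁ hq₂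
  have side : ∀ (γ : ℝ → ℂ) (a b : ℝ), Continuous γ → a ≤ b → (∀ t, γ t ≠ z₀) →
      (∀ t ∈ Icc a b, γ t ∈ Icc r₁ r₂ ×ℂ Icc q₁ q₂) →
      (∫ t in a..b, dslope g z₀ (γ t)) =
        (∫ t in a..b, g (γ t) / (γ t - z₀)) - g z₀ * ∫ t in a..b, 1 / (γ t - z₀) := by
    intro γ a b hγ hab hne hmem
    have hinv : Continuous fun t => 1 / (γ t - z₀) :=
      continuous_const.div (by fun_prop) fun t => sub_ne_zero.2 (hne t)
    have hcg : ContinuousOn (fun t => g (γ t)) (uIcc a b) :=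
      hg.continuousOn.comp hγ.continuousOn (by rwa [uIcc_of_le hab])
    rw [← intervalIntegral.integral_const_mul, ← intervalIntegral.integral_sub]
    · refine intervalIntegral.integral_congr fun t _ => ?_
      simp only [dslope_of_ne g (hne t), slope_def_field]
      ring
    · exact ((hcg.mul hinv.continuousOn).congr
        fun t _ => div_eq_mul_one_div _ _).intervalIntegrable
    · exact (continuous_const.mul hinv).intervalIntegrable _ _
  rw [side (fun t => t + q₁ * I) _ _ (by fun_prop) hr, side (fun t => t + q₂ * I) _ _ (by fun_prop)
    hr, side (fun t => r₂ + t * I) _ _ (by fun_prop) hq, side (fun t => r₁ + t * I) _ _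
    (by fun_prop) hq] at h0
  · linear_combination h0 + g z₀ * hw
  all_goals first
    | (intro t ht; simp only [mem_Icc] at ht; simp [mem_reProdIm]; constructor <;> linarith)
    | (intro t ht; simp only [mem_Icc] at ht; simp [mem_reProdIm, ht]; linarith)
    | (intro t ht; have h1 := congrArg re ht; have h2 := congrArg im ht; simp at h1 h2; linarith)

variable {N : ℕ}

/-- The real coordinates on `ℂᴺ`: `(i, false)` is the real part and `(i, true)` the imaginary part
of the `i`-th complex coordinate. -/
def reCoord (k : Fin N × Bool) (z : Fin N → ℂ) : ℝ := if k.2 then (z k.1).im else (z k.1).re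

@[simp] lemma reCoord_false (i : Fin N) (z : Fin N → ℂ) : reCoord (i, false) z = (z i).re := rfl

@[simp] lemma reCoord_true (i : Fin N) (z : Fin N → ℂ) : reCoord (i, true) z = (z i).im := rfl

lemma continuous_reCoord (k : Fin N × Bool) : Continuous (reCoord k) := by
  rcases k with ⟨i, _ | _⟩
  · exact Complex.continuous_re.comp (continuous_apply i)
  · exact Complex.continuous_im.comp (continuous_apply i)

/-- The closed box in `ℂᴺ` with given bounds on the real coordinates. -/
def coordBox (a b : Fin N × Bool → ℝ) : Set (Fin N → ℂ) :=
  {z | ∀ k, a k ≤ reCoord k z ∧ reCoord k z ≤ b k}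

lemma isCompact_coordBox (a b : Fin N × Bool → ℝ) : IsCompact (coordBox a b) := by
  convert isCompact_univ_pi (fun i : Fin N =>
    (isCompact_Icc (a := a (i, false)) (b := b (i, false))).reProdIm
      (isCompact_Icc (a := a (i, true)) (b := b (i, true))))
  ext z
  simp [coordBox, Complex.mem_reProdIm, Prod.forall]

lemma exists_thickening_coordBox_subset {a b : Fin N × Bool → ℝ} (hab : ∀ k, a k ≤ b k)
    {O : Set (Fin N → ℂ)} (hO : IsOpen O) (h : coordBox a b ⊆ O) :
    ∃ δ > 0, coordBox (fun k => a k - δ) (fun k => b k + δ) ⊆ O := by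
  obtain ⟨ε, hε, hεO⟩ := (isCompact_coordBox a b).exists_cthickening_subset_open hO h
  refine ⟨ε / 2, half_pos hε, fun z hz => hεO ?_⟩
  let clamp : Fin N × Bool → ℝ := fun k => max (a k) (min (b k) (reCoord k z))
  have hclamp : ∀ k, a k ≤ clamp k ∧ clamp k ≤ b k := fun k =>
    ⟨le_max_left _ _, max_le (hab k) (min_le_left _ _)⟩
  have hdist : ∀ k, |reCoord k z - clamp k| ≤ ε / 2 := fun k => by
    have h1 := hz k
    have h2 := hab k
    rw [abs_le]
    simp only [clamp, max_def, min_def]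
    split_ifs <;> constructor <;> linarith
  refine Metric.mem_cthickening_of_dist_le z
    (fun i => ⟨clamp (i, false), clamp (i, true)⟩) ε _ ?_ ?_
  · rintro ⟨i, _ | _⟩
    · simpa using hclamp (i, false)
    · simpa using hclamp (i, true)
  · refine (dist_pi_le_iff hε.le).2 fun i => ?_
    rw [dist_eq_norm]
    refine (Complex.norm_le_abs_re_add_abs_im _).trans ?_
    have h1 := hdist (i, false)
    have h2 := hdist (i, true)
    simp only [reCoord_false, reCoord_true] at h1 h2
    simp only [Complex.sub_re, Complex.sub_im]
    linarith

lemma contDiff_update_prod (i : Fin N) :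
    ContDiff ℂ 1 (fun q : ℂ × (Fin N → ℂ) => Function.update q.2 i q.1) := by
  refine contDiff_pi.2 fun j => ?_
  by_cases hj : j = i
  · subst hj; simpa using contDiff_fst
  · simp only [Function.update_of_ne hj]
    exact (contDiff_apply ℂ ℂ j).comp contDiff_snd

lemma contDiffAt_cauchyKernel {h : (Fin N → ℂ) → ℂ} {i : Fin N} {ζ : ℂ} {x : Fin N → ℂ}
    (hh : ContDiffAt ℂ 1 h (Function.update x i ζ)) (hne : ζ ≠ x i) :
    ContDiffAt ℂ 1 (fun q : ℂ × (Fin N → ℂ) => h (Function.update q.2 i q.1) / (q.1 - q.2 i))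
      (ζ, x) := by
  refine ContDiffAt.div ?_ ?_ (sub_ne_zero.2 hne)
  · exact ContDiffAt.comp (ζ, x) hh (contDiff_update_prod i).contDiffAt
  · exact contDiffAt_fst.sub ((contDiff_apply ℂ ℂ i).comp contDiff_snd).contDiffAt

/-- The polyhedron cut out of a box by the conditions `|re p|, |im p| ≤ M` for `p ∈ ps`. -/
def polyhedron (M : ℝ) (a b : Fin N × Bool → ℝ) (ps : List ((Fin N → ℂ) → ℂ)) :
    Set (Fin N → ℂ) :=
  {z | z ∈ coordBox a b ∧ ∀ p ∈ ps, |(p z).re| ≤ M ∧ |(p z).im| ≤ M}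

/-- Additive splitting across real coordinate hyperplanes: a function holomorphic near the slice
`reCoord k = c` of a polyhedron is a difference of functions holomorphic near its two halves. -/
def Splits (M : ℝ) (ps : List ((Fin N → ℂ) → ℂ)) : Prop :=
  ∀ (a b : Fin N × Bool → ℝ) (k : Fin N × Bool) (c : ℝ) (h : (Fin N → ℂ) → ℂ),
    (∀ x ∈ polyhedron M a b ps, reCoord k x = c → ContDiffAt ℂ 1 h x) →
    ∃ f₁ f₂ : (Fin N → ℂ) → ℂ,
      (∀ x ∈ polyhedron M a b ps, reCoord k x ≤ c → ContDiffAt ℂ 1 f₁ x) ∧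
      (∀ x ∈ polyhedron M a b ps, c ≤ reCoord k x → ContDiffAt ℂ 1 f₂ x) ∧
      ∀ x ∈ polyhedron M a b ps, reCoord k x = c → ∀ᶠ y in 𝓝 x, h y = f₁ y - f₂ y

open Complex in
lemma splits_nil (M : ℝ) : Splits M ([] : List ((Fin N → ℂ) → ℂ)) := by
  intro a b k c h hh
  simp only [polyhedron, List.not_mem_nil, false_imp_iff, implies_true, and_true,
    ofPred_mem_eq] at hh ⊢
  by_cases hne : ∃ x ∈ coordBox a b, reCoord k x = c
  swap
  · exact ⟨0, 0, fun _ _ _ => contDiffAt_const, fun _ _ _ => contDiffAt_const,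
      fun x hx hc => (hne ⟨x, hx, hc⟩).elim⟩
  obtain ⟨x₀, hx₀, hx₀c⟩ := hne
  set a₀ := Function.update a k c with ha₀
  set b₀ := Function.update b k c with hb₀
  have hbox : ∀ x, x ∈ coordBox a₀ b₀ ↔ (∀ j ≠ k, a j ≤ reCoord j x ∧ reCoord j x ≤ b j) ∧
      reCoord k x = c := by
    intro x
    constructor
    · intro hx
      refine ⟨fun j hj => by simpa [ha₀, hb₀, hj] using hx j, ?_⟩
      have := hx k
      simp only [ha₀, hb₀, Function.update_self] at this
      exact le_antisymm this.2 this.1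
    · rintro ⟨hx, hc⟩ j
      by_cases hj : j = k
      · subst hj; simp [ha₀, hb₀, hc]
      · simpa [ha₀, hb₀, hj] using hx j hj
  have hkab : a k ≤ c ∧ c ≤ b k := hx₀c ▸ hx₀ k
  have hx₀' : x₀ ∈ coordBox a₀ b₀ := (hbox x₀).2 ⟨fun j _ => hx₀ j, hx₀c⟩
  have hO : IsOpen {x | ContDiffAt ℂ 1 h x} :=
    isOpen_iff_mem_nhds.2 fun x hx => ContDiffAt.eventually hx (by simp)
  obtain ⟨δ, hδ, hsub⟩ := exists_thickening_coordBox_subset (O := {x | ContDiffAt ℂ 1 h x})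
    (fun k => (hx₀' k).1.trans (hx₀' k).2) hO (by
      intro x hx
      obtain ⟨h1, h2⟩ := (hbox x).1 hx
      refine hh x (fun j => ?_) h2
      by_cases hj : j = k
      · subst hj; rwa [h2]
      · exact h1 j hj)
  obtain ⟨i, s⟩ := k
  -- points whose other coordinates are close to those of the slice
  set W : Set (Fin N → ℂ) := {x | ∀ j s', j ≠ i → a (j, s') - δ < reCoord (j, s') x ∧
    reCoord (j, s') x < b (j, s') + δ} with hW
  have hWo : IsOpen W := by
    simp only [hW, ofPred_forall]
    refine isOpen_iInter_of_finite fun j => isOpen_iInter_of_finite fun s' =>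
      isOpen_iInter_of_finite fun _ => ?_
    exact (isOpen_lt continuous_const (continuous_reCoord _)).inter
      (isOpen_lt (continuous_reCoord _) continuous_const)
  have hBW : coordBox a b ⊆ W := fun x hx j s' _ => by
    have := hx (j, s')
    constructor <;> linarith
  set r₁ := a₀ (i, false) - δ with hr₁
  set r₂ := b₀ (i, false) + δ with hr₂
  set q₁ := a₀ (i, true) - δ with hq₁
  set q₂ := b₀ (i, true) + δ with hq₂
  have hr : r₁ ≤ r₂ := by
    have := (hx₀' (i, false)).1.trans (hx₀' (i, false)).2
    linarith
  have hq : q₁ ≤ q₂ := by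
    have := (hx₀' (i, true)).1.trans (hx₀' (i, true)).2
    linarith
  have hupd : ∀ x ∈ W, ∀ ζ ∈ Icc r₁ r₂ ×ℂ Icc q₁ q₂,
      ContDiffAt ℂ 1 h (Function.update x i ζ) := by
    intro x hx ζ hζ
    refine hsub ?_
    rintro ⟨j, s'⟩
    by_cases hj : j = i
    · subst hj
      cases s'
      · simp only [reCoord_false, Function.update_self]
        exact hζ.1
      · simp only [reCoord_true, Function.update_self]
        exact hζ.2
    · have h1 := hx j s' hj
      have h2 : (j, s') ≠ (i, s) := fun e => hj (congrArg Prod.fst e)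
      simp only [ha₀, hb₀, Function.update_of_ne h2]
      cases s'
      · simp only [reCoord_false, Function.update_of_ne hj] at h1 ⊢
        exact ⟨h1.1.le, h1.2.le⟩
      · simp only [reCoord_true, Function.update_of_ne hj] at h1 ⊢
        exact ⟨h1.1.le, h1.2.le⟩
  let Ψ : ℂ × (Fin N → ℂ) → ℂ := fun q => h (Function.update q.2 i q.1) / (q.1 - q.2 i)
  let Jbot : (Fin N → ℂ) → ℂ := fun z => ∫ t : ℝ in r₁..r₂, Ψ (t + q₁ * I, z)
  let Jtop : (Fin N → ℂ) → ℂ := fun z => ∫ t : ℝ in r₁..r₂, Ψ (t + q₂ * I, z)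
  let Jright : (Fin N → ℂ) → ℂ := fun z => ∫ t : ℝ in q₁..q₂, Ψ (r₂ + t * I, z)
  let Jleft : (Fin N → ℂ) → ℂ := fun z => ∫ t : ℝ in q₁..q₂, Ψ (r₁ + t * I, z)
  have hbot : ∀ x ∈ W, q₁ < (x i).im → ContDiffAt ℂ 1 Jbot x := by
    intro x hx hlt
    refine contDiffAt_one_pathIntegral (γ := fun t : ℝ => t + q₁ * I) (by fun_prop) fun t ht => ?_
    rw [uIcc_of_le hr] at ht
    refine contDiffAt_cauchyKernel (hupd x hx _ ?_) fun e => ?_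
    · simpa [mem_reProdIm, hq] using ht
    · have := congrArg im e; simp at this; linarith
  have htop : ∀ x ∈ W, (x i).im < q₂ → ContDiffAt ℂ 1 Jtop x := by
    intro x hx hlt
    refine contDiffAt_one_pathIntegral (γ := fun t : ℝ => t + q₂ * I) (by fun_prop) fun t ht => ?_
    rw [uIcc_of_le hr] at ht
    refine contDiffAt_cauchyKernel (hupd x hx _ ?_) fun e => ?_
    · simpa [mem_reProdIm, hq] using ht
    · have := congrArg im e; simp at this; linarith
  have hright : ∀ x ∈ W, (x i).re < r₂ → ContDiffAt ℂ 1 Jright x := by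
    intro x hx hlt
    refine contDiffAt_one_pathIntegral (γ := fun t : ℝ => r₂ + t * I) (by fun_prop) fun t ht => ?_
    rw [uIcc_of_le hq] at ht
    refine contDiffAt_cauchyKernel (hupd x hx _ ?_) fun e => ?_
    · simpa [mem_reProdIm, hr] using ht
    · have := congrArg re e; simp at this; linarith
  have hleft : ∀ x ∈ W, r₁ < (x i).re → ContDiffAt ℂ 1 Jleft x := by
    intro x hx hlt
    refine contDiffAt_one_pathIntegral (γ := fun t : ℝ => r₁ + t * I) (by fun_prop) fun t ht => ?_
    rw [uIcc_of_le hq] at ht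
    refine contDiffAt_cauchyKernel (hupd x hx _ ?_) fun e => ?_
    · simpa [mem_reProdIm, hr] using ht
    · have := congrArg re e; simp at this; linarith
  have hcauchy : ∀ y ∈ W, r₁ < (y i).re → (y i).re < r₂ → q₁ < (y i).im → (y i).im < q₂ →
      Jbot y - Jtop y + I * Jright y - I * Jleft y = 2 * Real.pi * I * h y := by
    intro y hy h1 h2 h3 h4
    have hd : DifferentiableOn ℂ (fun ζ => h (Function.update y i ζ))
        (Icc r₁ r₂ ×ℂ Icc q₁ q₂) := fun ζ hζ => by
      have hp : ContDiffAt ℂ 1 (fun ζ : ℂ => (ζ, y)) ζ := contDiffAt_id.prodMk contDiffAt_const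
      exact ((((hupd y hy ζ hζ).comp (ζ, y) (contDiff_update_prod i).contDiffAt).comp ζ
        hp).differentiableAt (by simp)).differentiableWithinAt
    simpa only [Function.update_eq_self] using integral_boundary_rect_div_sub h1 h2 h3 h4 hd
  have hev : ∀ x ∈ coordBox a b, reCoord (i, s) x = c → ∀ᶠ y in 𝓝 x,
      Jbot y - Jtop y + I * Jright y - I * Jleft y = 2 * Real.pi * I * h y := by
    intro x hx hc
    have hx' : x ∈ coordBox a₀ b₀ := (hbox x).2 ⟨fun j _ => hx j, hc⟩
    have h1 := hx' (i, false)
    have h2 := hx' (i, true)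
    simp only [reCoord_false, reCoord_true] at h1 h2
    have hre : ContinuousAt (fun y : Fin N → ℂ => (y i).re) x :=
      (continuous_reCoord (i, false)).continuousAt
    have him : ContinuousAt (fun y : Fin N → ℂ => (y i).im) x :=
      (continuous_reCoord (i, true)).continuousAt
    filter_upwards [hWo.mem_nhds (hBW hx),
      hre.eventually (isOpen_Ioo.mem_nhds (x := (x i).re) (s := Ioo r₁ r₂)
        ⟨by linarith, by linarith⟩),
      him.eventually (isOpen_Ioo.mem_nhds (x := (x i).im) (s := Ioo q₁ q₂)
        ⟨by linarith, by linarith⟩)] with y hy hy1 hy2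
    exact hcauchy y hy hy1.1 hy1.2 hy2.1 hy2.2
  have hpi : (2 * Real.pi * I : ℂ) ≠ 0 := two_pi_I_ne_zero
  cases s with
  | false =>
    have e1 : r₁ = c - δ := by simp [hr₁, ha₀]
    have e2 : r₂ = c + δ := by simp [hr₂, hb₀]
    have e3 : q₁ = a (i, true) - δ := by simp [hq₁, ha₀]
    have e4 : q₂ = b (i, true) + δ := by simp [hq₂, hb₀]
    refine ⟨fun z => (2 * Real.pi * I)⁻¹ * (Jbot z - Jtop z + I * Jright z),
      fun z => (2 * Real.pi * I)⁻¹ * (I * Jleft z), fun x hx hc => ?_, fun x hx hc => ?_,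
      fun x hx hc => ?_⟩
    · have him := hx (i, true)
      simp only [reCoord_false, reCoord_true] at hc him
      exact contDiffAt_const.mul (((hbot x (hBW hx) (by linarith)).sub
        (htop x (hBW hx) (by linarith))).add
        (contDiffAt_const.mul (hright x (hBW hx) (by linarith))))
    · simp only [reCoord_false] at hc
      exact contDiffAt_const.mul (contDiffAt_const.mul (hleft x (hBW hx) (by linarith)))
    · filter_upwards [hev x hx hc] with y hy
      rw [← mul_sub, hy, inv_mul_cancel_left₀ hpi]
  | true =>
    have e1 : q₁ = c - δ := by simp [hq₁, ha₀]
    have e2 : q₂ = c + δ := by simp [hq₂, hb₀]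
    have e3 : r₁ = a (i, false) - δ := by simp [hr₁, ha₀]
    have e4 : r₂ = b (i, false) + δ := by simp [hr₂, hb₀]
    refine ⟨fun z => (2 * Real.pi * I)⁻¹ * (I * Jright z - I * Jleft z - Jtop z),
      fun z => (2 * Real.pi * I)⁻¹ * (-Jbot z), fun x hx hc => ?_, fun x hx hc => ?_,
      fun x hx hc => ?_⟩
    · have hre := hx (i, false)
      simp only [reCoord_false, reCoord_true] at hc hre
      exact contDiffAt_const.mul (((contDiffAt_const.mul (hright x (hBW hx) (by linarith))).sub
        (contDiffAt_const.mul (hleft x (hBW hx) (by linarith)))).sub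
        (htop x (hBW hx) (by linarith)))
    · simp only [reCoord_true] at hc
      exact contDiffAt_const.mul (hbot x (hBW hx) (by linarith)).neg
    · filter_upwards [hev x hx hc] with y hy
      rw [← mul_sub, eq_inv_mul_iff_mul_eq₀ hpi]
      linear_combination -hy

lemma mem_coordBox_update_right {a b : Fin N × Bool → ℝ} {x : Fin N → ℂ} (hx : x ∈ coordBox a b)
    {k : Fin N × Bool} {c : ℝ} (hc : reCoord k x ≤ c) :
    x ∈ coordBox a (Function.update b k c) := fun j => by
  by_cases hj : j = k
  · subst hj; simpa [hc] using (hx j).1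
  · simpa [hj] using hx j

lemma mem_coordBox_update_left {a b : Fin N × Bool → ℝ} {x : Fin N → ℂ} (hx : x ∈ coordBox a b)
    {k : Fin N × Bool} {c : ℝ} (hc : c ≤ reCoord k x) :
    x ∈ coordBox (Function.update a k c) b := fun j => by
  by_cases hj : j = k
  · subst hj; simpa [hc] using (hx j).2
  · simpa [hj] using hx j

lemma isCompact_polyhedron (M : ℝ) (a b : Fin N × Bool → ℝ) {ps : List ((Fin N → ℂ) → ℂ)}
    (hps : ∀ p ∈ ps, Continuous p) : IsCompact (polyhedron M a b ps) := by
  refine (isCompact_coordBox a b).inter_right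
    (t := {z | ∀ p ∈ ps, |(p z).re| ≤ M ∧ |(p z).im| ≤ M}) ?_
  simp only [ofPred_forall]
  refine isClosed_iInter fun p => isClosed_iInter fun hp => ?_
  have := hps p hp
  exact (isClosed_le (Complex.continuous_re.comp this).abs continuous_const).inter
    (isClosed_le (Complex.continuous_im.comp this).abs continuous_const)

lemma mem_polyhedron_sup_inf {M : ℝ} {a b a' b' : Fin N × Bool → ℝ}
    {ps : List ((Fin N → ℂ) → ℂ)} {x : Fin N → ℂ} :
    x ∈ polyhedron M (a ⊔ a') (b ⊓ b') ps ↔ x ∈ polyhedron M a b ps ∧ x ∈ coordBox a' b' := by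
  have : x ∈ coordBox (a ⊔ a') (b ⊓ b') ↔ x ∈ coordBox a b ∧ x ∈ coordBox a' b' := by
    simp only [coordBox, mem_ofPred_eq, Pi.sup_apply, Pi.inf_apply, sup_le_iff, le_inf_iff,
      ← forall_and]
    exact forall_congr' fun k => by tauto
  simp only [polyhedron, mem_ofPred_eq, this]
  tauto

/-- An additive Cousin problem on a polyhedron: local solutions, whose differences are holomorphic,
can be modified by holomorphic functions so as to fit together. -/
lemma exists_cousin_solution {M : ℝ} {ps : List ((Fin N → ℂ) → ℂ)} (hs : Splits M ps)
    (hps : ∀ p ∈ ps, Continuous p) (Good : ((Fin N → ℂ) → ℂ) → (Fin N → ℂ) → Prop)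
    (hcongr : ∀ G G' x, Good G x → G =ᶠ[𝓝 x] G' → Good G' x)
    (hdiff : ∀ G G' x, Good G x → Good G' x → ContDiffAt ℂ 1 (G - G') x)
    (hsub : ∀ G h x, Good G x → ContDiffAt ℂ 1 h x → Good (G - h) x)
    (a b : Fin N × Bool → ℝ)
    (hloc : ∀ x ∈ polyhedron M a b ps, ∃ G, ∀ᶠ y in 𝓝 x, Good G y) :
    ∃ G, ∀ x ∈ polyhedron M a b ps, Good G x := by
  have glue : ∀ (a' b' : Fin N × Bool → ℝ) (k : Fin N × Bool) (c : ℝ) (G₁ G₂ : (Fin N → ℂ) → ℂ),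
      (∀ x ∈ polyhedron M a b ps, x ∈ coordBox a' b' → reCoord k x ≤ c → Good G₁ x) →
      (∀ x ∈ polyhedron M a b ps, x ∈ coordBox a' b' → c ≤ reCoord k x → Good G₂ x) →
      ∃ G, ∀ x ∈ polyhedron M a b ps, x ∈ coordBox a' b' → Good G x := by
    intro a' b' k c G₁ G₂ h₁ h₂
    obtain ⟨f₁, f₂, hf₁, hf₂, hf⟩ := hs (a ⊔ a') (b ⊓ b') k c (G₁ - G₂) fun x hx hc => by
      rw [mem_polyhedron_sup_inf] at hx
      exact hdiff _ _ _ (h₁ x hx.1 hx.2 hc.le) (h₂ x hx.1 hx.2 hc.ge)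
    have hk := (continuous_reCoord k)
    refine ⟨fun y => if reCoord k y ≤ c then (G₁ - f₁) y else (G₂ - f₂) y, fun x hx hx' => ?_⟩
    have hxx := mem_polyhedron_sup_inf.2 ⟨hx, hx'⟩
    rcases lt_trichotomy (reCoord k x) c with hlt | heq | hgt
    · refine hcongr _ _ _ (hsub _ _ _ (h₁ x hx hx' hlt.le) (hf₁ x hxx hlt.le)) ?_
      filter_upwards [hk.continuousAt.eventually_lt continuousAt_const hlt] with y hy
      rw [if_pos hy.le]
    · refine hcongr _ _ _ (hsub _ _ _ (h₁ x hx hx' heq.le) (hf₁ x hxx heq.le)) ?_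
      filter_upwards [hf x hxx heq] with y hy
      split_ifs
      · rfl
      · simp only [Pi.sub_apply] at hy ⊢
        linear_combination hy
    · refine hcongr _ _ _ (hsub _ _ _ (h₂ x hx hx' hgt.le) (hf₂ x hxx hgt.le)) ?_
      filter_upwards [continuousAt_const.eventually_lt hk.continuousAt hgt] with y hy
      rw [if_neg (not_le.2 hy)]
  obtain ⟨δ, hδ, hleb⟩ := lebesgue_number_lemma_of_metric (isCompact_polyhedron M a b hps)
    (c := fun G => interior {y | Good G y}) (fun _ => isOpen_interior) fun x hx => by
      obtain ⟨G, hG⟩ := hloc x hx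
      exact mem_iUnion.2 ⟨G, mem_interior_iff_mem_nhds.2 hG⟩
  have hfin : ∀ (S : Finset (Fin N × Bool)) (a' b' : Fin N × Bool → ℝ),
      (∀ k ∉ S, b' k - a' k ≤ δ / 4) →
      ∃ G, ∀ x ∈ polyhedron M a b ps, x ∈ coordBox a' b' → Good G x := by
    intro S
    induction S using Finset.induction_on with
    | empty =>
      intro a' b' hsmall
      by_cases hne : ∃ x ∈ polyhedron M a b ps, x ∈ coordBox a' b'
      · obtain ⟨x, hx, hx'⟩ := hne
        obtain ⟨G, hG⟩ := hleb x hx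
        refine ⟨G, fun y _ hy' => interior_subset (hG ?_)⟩
        refine (dist_pi_lt_iff hδ).2 fun i => ?_
        rw [dist_eq_norm]
        refine (Complex.norm_le_abs_re_add_abs_im _).trans_lt ?_
        have hb : ∀ k, |reCoord k y - reCoord k x| ≤ δ / 4 := fun k => by
          have h1 := hsmall k (Finset.notMem_empty k)
          have h2 := hx' k
          have h3 := hy' k
          rw [abs_le]
          constructor <;> linarith
        have h1 := hb (i, false)
        have h2 := hb (i, true)
        simp only [reCoord_false, reCoord_true] at h1 h2
        simp only [Complex.sub_re, Complex.sub_im]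
        linarith
      · exact ⟨0, fun x hx hx' => (hne ⟨x, hx, hx'⟩).elim⟩
    | insert k S hkS ih =>
      have hm : ∀ (m : ℕ) (a' b' : Fin N × Bool → ℝ), (∀ j ∉ insert k S, b' j - a' j ≤ δ / 4) →
          b' k - a' k ≤ (m + 1) * (δ / 4) →
          ∃ G, ∀ x ∈ polyhedron M a b ps, x ∈ coordBox a' b' → Good G x := by
        intro m
        induction m with
        | zero =>
          intro a' b' hsmall hk
          refine ih a' b' fun j hj => ?_
          by_cases hjk : j = k
          · subst hjk; simpa using hk
          · exact hsmall j (by simp [hjk, hj])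
        | succ m ihm =>
          intro a' b' hsmall hk
          obtain ⟨G₁, hG₁⟩ := ih a' (Function.update b' k (a' k + δ / 4)) fun j hj => by
            by_cases hjk : j = k
            · subst hjk; simp
            · simpa [hjk] using hsmall j (by simp [hjk, hj])
          obtain ⟨G₂, hG₂⟩ := ihm (Function.update a' k (a' k + δ / 4)) b'
            (fun j hj => by
              have hjk : j ≠ k := fun e => hj (by simp [e])
              simpa [hjk] using hsmall j hj)
            (by
              push_cast at hk
              simp only [Function.update_self]
              linarith)
          exact glue a' b' k (a' k + δ / 4) G₁ G₂
            (fun x hx hx' hc => hG₁ x hx (mem_coordBox_update_right hx' hc))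
            (fun x hx hx' hc => hG₂ x hx (mem_coordBox_update_left hx' hc))
      intro a' b' hsmall
      obtain ⟨m, hm'⟩ := exists_nat_ge ((b' k - a' k) / (δ / 4))
      refine hm m a' b' hsmall ?_
      rw [div_le_iff₀ (by positivity)] at hm'
      linarith
  obtain ⟨G, hG⟩ := hfin Finset.univ a b fun k hk => (hk (Finset.mem_univ k)).elim
  exact ⟨G, fun x hx => hG x hx hx.1⟩

/-- Prepend to a family of bounds on real coordinates the bound `c` for both parts of a new complex
coordinate. -/
def consBound (c : ℝ) (a : Fin N × Bool → ℝ) : Fin (N + 1) × Bool → ℝ :=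
  fun k => Fin.cases c (fun i => a (i, k.2)) k.1

lemma mem_polyhedron_cons {M : ℝ} {a b : Fin N × Bool → ℝ} {ps : List ((Fin N → ℂ) → ℂ)}
    {z : Fin (N + 1) → ℂ} :
    z ∈ polyhedron M (consBound (-M) a) (consBound M b) (ps.map (· ∘ Fin.tail)) ↔
      (|(z 0).re| ≤ M ∧ |(z 0).im| ≤ M) ∧ Fin.tail z ∈ polyhedron M a b ps := by
  have : z ∈ coordBox (consBound (-M) a) (consBound M b) ↔
      (|(z 0).re| ≤ M ∧ |(z 0).im| ≤ M) ∧ Fin.tail z ∈ coordBox a b := by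
    simp [coordBox, Prod.forall, Fin.forall_fin_succ, consBound, abs_le, Fin.tail]
  simp only [polyhedron, mem_ofPred_eq, this, List.forall_mem_map, Function.comp_apply]
  tauto

lemma contDiff_tail : ContDiff ℂ 1 (Fin.tail : (Fin (N + 1) → ℂ) → Fin N → ℂ) :=
  contDiff_pi.2 fun i => contDiff_apply ℂ ℂ i.succ

lemma contDiff_graph {p : (Fin N → ℂ) → ℂ} (hp : ContDiff ℂ 1 p) :
    ContDiff ℂ 1 (fun z => (Fin.cons (p z) z : Fin (N + 1) → ℂ)) := by
  refine contDiff_pi.2 fun i => ?_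
  refine Fin.cases ?_ (fun j => ?_) i
  · simpa using hp
  · simpa using contDiff_apply ℂ ℂ j

/-- **Oka's lemma**: a function holomorphic near a polyhedron is the restriction to the graph of
one of the defining functions `p` of a function holomorphic near the polyhedron, in one more
variable, from which the condition on `p` has been dropped. -/
lemma exists_extension_of_splits {M : ℝ} {p : (Fin N → ℂ) → ℂ} {ps : List ((Fin N → ℂ) → ℂ)}
    (hp : ContDiff ℂ 1 p) (hps : ∀ q ∈ ps, ContDiff ℂ 1 q)
    (hs : Splits M (ps.map (· ∘ (Fin.tail : (Fin (N + 1) → ℂ) → Fin N → ℂ))))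
    (a b : Fin N × Bool → ℝ) {f : (Fin N → ℂ) → ℂ}
    (hf : ∀ x ∈ polyhedron M a b (p :: ps), ContDiffAt ℂ 1 f x) :
    ∃ F : (Fin (N + 1) → ℂ) → ℂ,
      (∀ x ∈ polyhedron M (consBound (-M) a) (consBound M b) (ps.map (· ∘ Fin.tail)),
        ContDiffAt ℂ 1 F x) ∧ ∀ z, F (Fin.cons (p z) z) = f z := by
  let d : (Fin (N + 1) → ℂ) → ℂ := fun y => y 0 - p (Fin.tail y)
  have hd : ContDiff ℂ 1 d := (contDiff_apply ℂ ℂ 0).sub (hp.comp contDiff_tail)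
  let s : (Fin (N + 1) → ℂ) → ℂ := fun y => f (Fin.tail y) / d y
  have hft : ∀ x : Fin (N + 1) → ℂ, ContDiffAt ℂ 1 f (Fin.tail x) →
      ContDiffAt ℂ 1 (fun y : Fin (N + 1) → ℂ => f (Fin.tail y)) x := fun x hx =>
    ContDiffAt.comp x hx contDiff_tail.contDiffAt
  have hs1 : ∀ x, ContDiffAt ℂ 1 f (Fin.tail x) → d x ≠ 0 → ContDiffAt ℂ 1 s x :=
    fun x hx hdx => (hft x hx).div hd.contDiffAt hdx
  obtain ⟨G, hG⟩ := exists_cousin_solution hs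
    (by
      simp only [List.forall_mem_map]
      exact fun q hq => ((hps q hq).comp contDiff_tail).continuous)
    (fun G x => (ContDiffAt ℂ 1 f (Fin.tail x) ∧ ContDiffAt ℂ 1 (G - s) x) ∨
      (d x ≠ 0 ∧ ContDiffAt ℂ 1 G x))
    (by
      rintro G G' x (⟨h1, h2⟩ | ⟨h1, h2⟩) he
      · exact Or.inl ⟨h1, h2.congr_of_eventuallyEq (he.symm.sub EventuallyEq.rfl)⟩
      · exact Or.inr ⟨h1, h2.congr_of_eventuallyEq he.symm⟩)
    (by
      rintro G G' x (⟨h1, h2⟩ | ⟨h1, h2⟩) (⟨h3, h4⟩ | ⟨h3, h4⟩)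
      · exact (h2.sub h4).congr_of_eventuallyEq (Eventually.of_forall fun y => by simp)
      · exact ((h2.add (hs1 x h1 h3)).sub h4).congr_of_eventuallyEq
          (Eventually.of_forall fun y => by simp)
      · exact (h2.sub (h4.add (hs1 x h3 h1))).congr_of_eventuallyEq
          (Eventually.of_forall fun y => by simp)
      · exact h2.sub h4)
    (by
      rintro G h x (⟨h1, h2⟩ | ⟨h1, h2⟩) hh
      · refine Or.inl ⟨h1, ?_⟩
        rw [sub_right_comm]
        exact h2.sub hh
      · exact Or.inr ⟨h1, h2.sub hh⟩)
    (consBound (-M) a) (consBound M b)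
    (by
      intro x hx
      rw [mem_polyhedron_cons] at hx
      by_cases hpx : |(p (Fin.tail x)).re| ≤ M ∧ |(p (Fin.tail x)).im| ≤ M
      · refine ⟨s, ?_⟩
        have h1 : ContDiffAt ℂ 1 f (Fin.tail x) := by
          refine hf _ ⟨hx.2.1, fun q hq => ?_⟩
          rcases List.mem_cons.1 hq with rfl | hq
          · exact hpx
          · exact hx.2.2 q hq
        have h2 : ∀ᶠ y in 𝓝 x, ContDiffAt ℂ 1 f (Fin.tail y) :=
          contDiff_tail.continuous.continuousAt.eventually (h1.eventually (by simp))
        filter_upwards [h2] with y hy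
        refine Or.inl ⟨hy, ?_⟩
        rw [sub_self]
        exact contDiffAt_const
      · refine ⟨0, ?_⟩
        have h1 : d x ≠ 0 := fun h => hpx (by rw [← sub_eq_zero.1 h]; exact hx.1)
        filter_upwards [hd.continuous.continuousAt.eventually_ne h1] with y hy
        exact Or.inr ⟨hy, contDiffAt_const⟩)
  classical
  refine ⟨fun y => if d y = 0 then f (Fin.tail y) else d y * G y, fun x hx => ?_, fun z => ?_⟩
  · rcases hG x hx with ⟨h1, h2⟩ | ⟨h1, h2⟩
    · refine ((hft x h1).add (hd.contDiffAt.mul h2)).congr_of_eventuallyEq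
        (Eventually.of_forall fun y => ?_)
      by_cases hy : d y = 0
      · simp [hy]
      · simp only [if_neg hy, Pi.sub_apply, s]
        field_simp
        ring
    · refine (hd.contDiffAt.mul h2).congr_of_eventuallyEq ?_
      filter_upwards [hd.continuous.continuousAt.eventually_ne h1] with y hy
      rw [if_neg hy]
  · have : d (Fin.cons (p z) z) = 0 := by simp [d]
    simp [this]

lemma splits_cons {M : ℝ} {p : (Fin N → ℂ) → ℂ} {ps : List ((Fin N → ℂ) → ℂ)}
    (hp : ContDiff ℂ 1 p) (hps : ∀ q ∈ ps, ContDiff ℂ 1 q)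
    (hs : Splits M (ps.map (· ∘ (Fin.tail : (Fin (N + 1) → ℂ) → Fin N → ℂ)))) :
    Splits M (p :: ps) := by
  intro a b k c h hh
  have hslice : ∀ x, x ∈ coordBox (a ⊔ Function.update a k c) (b ⊓ Function.update b k c) ↔
      x ∈ coordBox a b ∧ reCoord k x = c := by
    intro x
    constructor
    · intro hx
      have hk := hx k
      simp only [Pi.sup_apply, Pi.inf_apply, Function.update_self, sup_le_iff, le_inf_iff] at hk
      exact ⟨fun j => ⟨le_sup_left.trans (hx j).1, (hx j).2.trans inf_le_left⟩,
        le_antisymm hk.2.2 hk.1.2⟩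
    · rintro ⟨hx, hc⟩ j
      have h1 := mem_coordBox_update_left hx hc.ge j
      have h2 := mem_coordBox_update_right hx hc.le j
      exact ⟨sup_le h2.1 h1.1, le_inf h1.2 h2.2⟩
  obtain ⟨F, hF, hFh⟩ := exists_extension_of_splits hp hps hs (a ⊔ Function.update a k c)
    (b ⊓ Function.update b k c) (f := h) fun x hx =>
      hh x ⟨((hslice x).1 hx.1).1, hx.2⟩ ((hslice x).1 hx.1).2
  have hk : ∀ x : Fin (N + 1) → ℂ, reCoord (k.1.succ, k.2) x = reCoord k (Fin.tail x) :=
    fun x => rfl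
  obtain ⟨F₁, F₂, hF₁, hF₂, hF₁₂⟩ := hs (consBound (-M) a) (consBound M b) (k.1.succ, k.2) c F
    fun x hx hc => by
      rw [mem_polyhedron_cons] at hx
      exact hF x (mem_polyhedron_cons.2 ⟨hx.1, (hslice _).2 ⟨hx.2.1, hc⟩, hx.2.2⟩)
  have hg := contDiff_graph hp
  have hmem : ∀ x ∈ polyhedron M a b (p :: ps), (Fin.cons (p x) x : Fin (N + 1) → ℂ) ∈
      polyhedron M (consBound (-M) a) (consBound M b) (ps.map (· ∘ Fin.tail)) := fun x hx =>
    mem_polyhedron_cons.2 ⟨by simpa using hx.2 p (by simp), by simpa using hx.1,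
      fun q hq => by simpa using hx.2 q (by simp [hq])⟩
  refine ⟨fun z => F₁ (Fin.cons (p z) z), fun z => F₂ (Fin.cons (p z) z), fun x hx hc => ?_,
    fun x hx hc => ?_, fun x hx hc => ?_⟩
  · exact ContDiffAt.comp x (hF₁ _ (hmem x hx) (by simpa [hk] using hc)) hg.contDiffAt
  · exact ContDiffAt.comp x (hF₂ _ (hmem x hx) (by simpa [hk] using hc)) hg.contDiffAt
  · filter_upwards [hg.continuous.continuousAt.eventually
      (hF₁₂ _ (hmem x hx) (by simpa [hk] using hc))] with y hy
    rw [← hFh y, hy]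

lemma splits_of_contDiff (M : ℝ) {m : ℕ} : ∀ {N : ℕ} {ps : List ((Fin N → ℂ) → ℂ)},
    ps.length = m → (∀ q ∈ ps, ContDiff ℂ 1 q) → Splits M ps := by
  induction m with
  | zero =>
    intro N ps hm _
    rw [List.length_eq_zero_iff.1 hm]
    exact splits_nil M
  | succ m ih =>
    intro N ps hm hps
    match ps, hm, hps with
    | p :: ps, hm, hps =>
      have hps' : ∀ q ∈ ps, ContDiff ℂ 1 q := fun q hq => hps q (by simp [hq])
      refine splits_cons (hps p (by simp)) hps' (ih (by simpa using hm) ?_)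
      simp only [List.forall_mem_map]
      exact fun q hq => (hps' q hq).comp contDiff_tail

/-- Error bound for the Taylor polynomials at `0` of a function holomorphic in a disc. -/
lemma norm_sub_sum_cauchy_le {φ : ℂ → ℂ} {r M C : ℝ} (hM : 0 ≤ M) (hr : M < r)
    (hφ : DifferentiableOn ℂ φ (Metric.closedBall 0 r))
    (hC : ∀ ζ ∈ Metric.closedBall (0 : ℂ) r, ‖φ ζ‖ ≤ C) {w : ℂ} (hw : ‖w‖ ≤ M) (n : ℕ) :
    ‖(∑ k ∈ Finset.range n, w ^ k * ((2 * Real.pi * Complex.I)⁻¹ *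
      ∮ ζ in C(0, r), ζ⁻¹ ^ (k + 1) * φ ζ)) - φ w‖ ≤ r * (C / (r - M)) * (M / r) ^ n := by
  have hr0 : 0 < r := hM.trans_lt hr
  have hC0 : 0 ≤ C := (norm_nonneg _).trans (hC 0 (by simpa using hr0.le))
  have hne : ∀ ζ ∈ Metric.sphere (0 : ℂ) r, ζ ≠ 0 ∧ ζ - w ≠ 0 ∧ ‖ζ‖ = r := by
    intro ζ hζ
    rw [mem_sphere_zero_iff_norm] at hζ
    refine ⟨norm_pos_iff.1 (by rw [hζ]; exact hr0), fun h => ?_, hζ⟩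
    rw [sub_eq_zero.1 h] at hζ
    linarith
  have hφc : ContinuousOn φ (Metric.sphere 0 r) :=
    hφ.continuousOn.mono Metric.sphere_subset_closedBall
  have hint : ∀ k : ℕ, CircleIntegrable (fun ζ => w ^ k * (ζ⁻¹ ^ (k + 1) * φ ζ)) 0 r := fun k =>
    (continuousOn_const.mul (((continuousOn_id.inv₀ fun ζ hζ => (hne ζ hζ).1).pow (k + 1)).mul
      hφc)).circleIntegrable hr0.le
  have hint' : CircleIntegrable (fun ζ => (ζ - w)⁻¹ • φ ζ) 0 r :=
    (ContinuousOn.smul ((continuousOn_id.sub continuousOn_const).inv₀ fun ζ hζ => (hne ζ hζ).2.1)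
      hφc).circleIntegrable hr0.le
  have hcauchy := (hφ.diffContOnCl_ball subset_rfl).two_pi_i_inv_smul_circleIntegral_sub_inv_smul
    (w := w) (by simpa using hw.trans_lt hr)
  have hsum : (∑ k ∈ Finset.range n, w ^ k * ((2 * Real.pi * Complex.I)⁻¹ *
      ∮ ζ in C(0, r), ζ⁻¹ ^ (k + 1) * φ ζ)) - φ w = (2 * Real.pi * Complex.I : ℂ)⁻¹ •
      ∮ ζ in C(0, r), ((∑ k ∈ Finset.range n, w ^ k * (ζ⁻¹ ^ (k + 1) * φ ζ)) -
        (ζ - w)⁻¹ • φ ζ) := by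
    rw [circleIntegral.integral_sub (CircleIntegrable.fun_sum _ fun k _ => hint k) hint',
      smul_sub, hcauchy, circleIntegral.integral_fun_sum fun k _ => hint k, Finset.smul_sum]
    congr 1
    refine Finset.sum_congr rfl fun k _ => ?_
    rw [circleIntegral.integral_const_mul, smul_eq_mul, mul_left_comm]
  rw [hsum, mul_assoc r]
  refine circleIntegral.norm_two_pi_i_inv_smul_integral_le_of_norm_le_const hr0.le fun ζ hζ => ?_
  obtain ⟨h0, h1, h2⟩ := hne ζ hζ
  have hgeom : (∑ k ∈ Finset.range n, w ^ k * (ζ⁻¹ ^ (k + 1) * φ ζ)) - (ζ - w)⁻¹ • φ ζ =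
      -((w / ζ) ^ n * (φ ζ / (ζ - w))) := by
    have h3 : w / ζ ≠ 1 := by
      rw [Ne, div_eq_one_iff_eq h0]
      exact fun h => h1 (by rw [h, sub_self])
    have h4 : ∑ k ∈ Finset.range n, w ^ k * (ζ⁻¹ ^ (k + 1) * φ ζ) =
        (∑ k ∈ Finset.range n, (w / ζ) ^ k) * (ζ⁻¹ * φ ζ) := by
      rw [Finset.sum_mul]
      exact Finset.sum_congr rfl fun k _ => by rw [div_eq_mul_inv]; ring
    have h5 : w - ζ ≠ 0 := fun h => h1 (by rw [← neg_sub, h, neg_zero])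
    have h6 : w / ζ - 1 = (w - ζ) / ζ := by field_simp
    rw [h4, geom_sum_eq h3, h6, smul_eq_mul, ← neg_sub w ζ]
    generalize (w / ζ) ^ n = u
    field_simp
    ring
  rw [hgeom, norm_neg, norm_mul, norm_pow, norm_div, norm_div, h2, mul_comm]
  have h7 : r - M ≤ ‖ζ - w‖ := by
    have := norm_sub_norm_le ζ w
    linarith
  have h8 := hC ζ (Metric.sphere_subset_closedBall hζ)
  have h9 : 0 < r - M := sub_pos.2 hr
  gcongr

/-- A function holomorphic near a closed polydisc and depending only on some of the variables is a
uniform limit of polynomials. -/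
lemma exists_polynomial_near_of_dependsOn {M : ℝ} (hM : 0 < M) (S : Finset (Fin N)) :
    ∀ {h : (Fin N → ℂ) → ℂ}, DependsOn h (S : Set (Fin N)) →
      (∀ x ∈ Metric.closedBall 0 M, ContDiffAt ℂ 1 h x) → ∀ {ε : ℝ}, 0 < ε →
      ∃ q : MvPolynomial (Fin N) ℂ, ∀ x ∈ Metric.closedBall 0 M, ‖eval x q - h x‖ < ε := by
  induction S using Finset.induction_on with
  | empty =>
    intro h hdep _ ε hε
    refine ⟨C (h 0), fun x _ => ?_⟩
    rw [eval_C, hdep (x := 0) (y := x) (by simp), sub_self, norm_zero]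
    exact hε
  | insert m S hm ih =>
    intro h hdep hh ε hε
    obtain ⟨r, hr, hhr⟩ : ∃ r > M, ∀ x ∈ Metric.closedBall (0 : Fin N → ℂ) r,
        ContDiffAt ℂ 1 h x := by
      obtain ⟨δ, hδ, H⟩ := (isCompact_closedBall (0 : Fin N → ℂ) M).exists_cthickening_subset_open
        (t := {x | ContDiffAt ℂ 1 h x})
        (isOpen_iff_mem_nhds.2 fun x hx => ContDiffAt.eventually hx (by simp)) hh
      rw [cthickening_closedBall hδ.le hM.le] at H
      exact ⟨δ + M, by linarith, fun x hx => H hx⟩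
    have hr0 : 0 < r := hM.trans hr
    have hupd : ∀ x ∈ Metric.closedBall (0 : Fin N → ℂ) M, ∀ ζ ∈ Metric.closedBall (0 : ℂ) r,
        Function.update x m ζ ∈ Metric.closedBall (0 : Fin N → ℂ) r := by
      intro x hx ζ hζ
      rw [mem_closedBall_zero_iff, pi_norm_le_iff_of_nonneg] at *
      · intro i
        by_cases hi : i = m
        · subst hi; simpa using hζ
        · simpa [Function.update_of_ne hi] using (hx i).trans hr.le
      all_goals positivity
    obtain ⟨B, hB⟩ := (isCompact_closedBall (0 : Fin N → ℂ) r).exists_bound_of_continuousOn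
      fun x hx => (hhr x hx).continuousAt.continuousWithinAt
    let c : ℕ → (Fin N → ℂ) → ℂ := fun k z => (2 * Real.pi * Complex.I)⁻¹ *
      ∮ ζ in C(0, r), ζ⁻¹ ^ (k + 1) * h (Function.update z m ζ)
    have hcdep : ∀ k, DependsOn (c k) (S : Set (Fin N)) := by
      intro k x y hxy
      have : ∀ ζ, h (Function.update x m ζ) = h (Function.update y m ζ) := fun ζ =>
        hdep fun i hi => by
          by_cases him : i = m
          · subst him; simp
          · simp only [Function.update_of_ne him]
            exact hxy i (by simpa [him] using hi)
      simp only [c, this]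
    have hcdiff : ∀ k, ∀ x ∈ Metric.closedBall (0 : Fin N → ℂ) M, ContDiffAt ℂ 1 (c k) x := by
      intro k x hx
      refine contDiffAt_const.mul ?_
      simp only [circleIntegral, deriv_circleMap]
      refine contDiffAt_one_pathIntegral (x := x) (a := 0) (b := 2 * Real.pi)
        (Ψ := fun q : ℂ × (Fin N → ℂ) =>
          (q.1 * Complex.I) • (q.1⁻¹ ^ (k + 1) *
            h (Function.update q.2 m q.1))) (γ := circleMap 0 r)
        (continuous_circleMap 0 r) fun t _ => ?_
      refine (contDiffAt_fst.mul contDiffAt_const).smul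
        (((contDiffAt_fst.inv ?_).pow (k + 1)).mul ?_)
      · exact circleMap_ne_center hr0.ne'
      · exact ContDiffAt.comp (circleMap 0 r t, x)
          (hhr _ (hupd x hx _ (circleMap_mem_closedBall 0 hr0.le t)))
          (contDiff_update_prod m).contDiffAt
    have hlim : Tendsto (fun n : ℕ => r * (B / (r - M)) * (M / r) ^ n) atTop (𝓝 0) := by
      simpa using (tendsto_pow_atTop_nhds_zero_of_lt_one (by positivity)
        ((div_lt_one hr0).2 hr)).const_mul (r * (B / (r - M)))
    obtain ⟨n, hn⟩ := (hlim.eventually_lt_const (half_pos hε)).exists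
    have hη : 0 < ε / 2 / ((∑ k ∈ Finset.range n, M ^ k) + 1) := by positivity
    choose q hq using fun k => ih (hcdep k) (hcdiff k) hη
    refine ⟨∑ k ∈ Finset.range n, X m ^ k * q k, fun x hx => ?_⟩
    have hxm : ‖x m‖ ≤ M := (norm_le_pi_norm x m).trans (by simpa using hx)
    have h1 := norm_sub_sum_cauchy_le hM.le hr (φ := fun ζ => h (Function.update x m ζ)) (C := B)
      (fun ζ hζ => (((hhr _ (hupd x hx ζ hζ)).differentiableAt (by simp)).comp ζ
        (((contDiff_update_prod m).comp (contDiff_id.prodMk contDiff_const)).differentiable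
          (by simp) ζ)).differentiableWithinAt) (fun ζ hζ => hB _ (hupd x hx ζ hζ)) hxm n
    rw [Function.update_eq_self] at h1
    have h2 : ‖∑ k ∈ Finset.range n, x m ^ k * (eval x (q k) - c k x)‖ ≤ ε / 2 := by
      refine (norm_sum_le _ _).trans ?_
      calc _ ≤ ∑ k ∈ Finset.range n, M ^ k * (ε / 2 / ((∑ k ∈ Finset.range n, M ^ k) + 1)) := by
            refine Finset.sum_le_sum fun k _ => ?_
            rw [norm_mul, norm_pow]
            have := (hq k x hx).le
            gcongr
        _ = (∑ k ∈ Finset.range n, M ^ k) / ((∑ k ∈ Finset.range n, M ^ k) + 1) * (ε / 2) := by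
            rw [← Finset.sum_mul]; ring
        _ ≤ 1 * (ε / 2) := by
            have : 0 ≤ ∑ k ∈ Finset.range n, M ^ k := by positivity
            gcongr
            rw [div_le_one (by positivity)]
            linarith
        _ = ε / 2 := one_mul _
    have h3 : eval x (∑ k ∈ Finset.range n, X m ^ k * q k) - h x =
        (∑ k ∈ Finset.range n, x m ^ k * (eval x (q k) - c k x)) +
          ((∑ k ∈ Finset.range n, x m ^ k * c k x) - h x) := by
      simp [mul_sub]
    rw [h3]
    exact (norm_add_le _ _).trans_lt (by linarith)

lemma contDiff_eval (p : MvPolynomial (Fin N) ℂ) : ContDiff ℂ 1 fun z => eval z p := by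
  induction p using MvPolynomial.induction_on with
  | C a => simpa using contDiff_const
  | add p q hp hq => simpa using hp.add hq
  | mul_X p i hp => simpa using hp.mul (contDiff_apply ℂ ℂ i)

lemma mem_coordBox_of_mem_closedBall {M : ℝ} {z : Fin N → ℂ} (hM : 0 ≤ M)
    (hz : z ∈ Metric.closedBall 0 M) : z ∈ coordBox (fun _ => -M) (fun _ => M) := by
  rw [mem_closedBall_zero_iff, pi_norm_le_iff_of_nonneg hM] at hz
  rintro ⟨i, _ | _⟩
  · exact abs_le.1 ((Complex.abs_re_le_norm _).trans (hz i))
  · exact abs_le.1 ((Complex.abs_im_le_norm _).trans (hz i))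

lemma consBound_const (c : ℝ) : consBound c (fun _ : Fin N × Bool => c) = fun _ => c := by
  ext ⟨i, s⟩
  refine Fin.cases ?_ (fun j => ?_) i <;> simp [consBound]

/-- A function holomorphic near a polynomial polyhedron is approximated by polynomials on the
smaller polyhedron defined by conditions on absolute values. -/
lemma exists_polynomial_near_of_polyhedron {M : ℝ} (hM : 0 < M) {m : ℕ} :
    ∀ {N : ℕ} {ps : List (MvPolynomial (Fin N) ℂ)}, ps.length = m →
      ∀ {f : (Fin N → ℂ) → ℂ},
      (∀ x ∈ polyhedron M (fun _ => -M) (fun _ => M) (ps.map fun p z => eval z p),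
        ContDiffAt ℂ 1 f x) → ∀ {ε : ℝ}, 0 < ε →
      ∃ q : MvPolynomial (Fin N) ℂ, ∀ z ∈ Metric.closedBall (0 : Fin N → ℂ) M,
        (∀ p ∈ ps, ‖eval z p‖ ≤ M) → ‖eval z q - f z‖ < ε := by
  induction m with
  | zero =>
    intro N ps hm f hf ε hε
    obtain rfl := List.length_eq_zero_iff.1 hm
    obtain ⟨q, hq⟩ := exists_polynomial_near_of_dependsOn hM Finset.univ (h := f)
      (fun x y hxy => congrArg f (funext fun i => hxy i (by simp)))
      (fun x hx => hf x ⟨mem_coordBox_of_mem_closedBall hM.le hx, by simp⟩) hε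
    exact ⟨q, fun z hz _ => hq z hz⟩
  | succ m ih =>
    intro N ps hm f hf ε hε
    match ps, hm, hf with
    | p :: ps, hm, hf =>
      have hps : ∀ q ∈ ps.map fun p z => eval z p, ContDiff ℂ 1 q := by
        simp only [List.forall_mem_map]
        exact fun q _ => contDiff_eval q
      obtain ⟨F, hF, hFf⟩ := exists_extension_of_splits (contDiff_eval p) hps
        (splits_of_contDiff M rfl (by
          simp only [List.map_map, List.forall_mem_map]
          exact fun q _ => (contDiff_eval q).comp contDiff_tail)) _ _ hf
      rw [consBound_const, consBound_const] at hF
      have hren : ((ps.map (rename Fin.succ)).map fun (p : MvPolynomial (Fin (N + 1)) ℂ) z =>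
          eval z p) = (ps.map fun p z => eval z p).map
            (· ∘ (Fin.tail : (Fin (N + 1) → ℂ) → Fin N → ℂ)) := by
        simp only [List.map_map]
        refine List.map_congr_left fun q _ => ?_
        ext z
        simp only [Function.comp_apply, eval_rename]
        rfl
      obtain ⟨q, hq⟩ := ih (ps := ps.map (rename Fin.succ)) (by simpa using hm) (f := F)
        (by rwa [hren]) hε
      refine ⟨bind₁ (Fin.cons p X : Fin (N + 1) → MvPolynomial (Fin N) ℂ) q, fun z hz hzp => ?_⟩
      have heval : eval z (bind₁ (Fin.cons p X : Fin (N + 1) → MvPolynomial (Fin N) ℂ) q) =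
          eval (Fin.cons (eval z p) z : Fin (N + 1) → ℂ) q := by
        rw [eval, eval₂Hom_bind₁]
        congr 2
        ext i
        refine Fin.cases ?_ (fun j => ?_) i <;> simp
      rw [heval, ← hFf z]
      refine hq _ ?_ ?_
      · rw [mem_closedBall_zero_iff, pi_norm_le_iff_of_nonneg hM.le] at hz ⊢
        refine Fin.cases ?_ fun j => ?_
        · simpa using hzp p (by simp)
        · simpa using hz j
      · simp only [List.forall_mem_map, eval_rename]
        exact fun q hq => hzp q (by simp [hq])

/-- **Oka-Weil theorem**. -/
theorem exists_polynomial_near_of_eq_polyHull {K V : Set (Fin N → ℂ)} (hK : IsCompact K)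
    (hne : K.Nonempty) (hhull : K = polyHull K) (hV : IsOpen V) (hKV : K ⊆ V)
    {g : (Fin N → ℂ) → ℂ} (hg : DifferentiableOn ℂ g V) {ε : ℝ} (hε : 0 < ε) :
    ∃ q : MvPolynomial (Fin N) ℂ, ∀ z ∈ K, ‖eval z q - g z‖ < ε := by
  obtain ⟨M, hM, hKM⟩ := hK.isBounded.subset_closedBall_lt 0 0
  have hsep : ∀ x ∈ coordBox (fun _ => -M) (fun _ => M) \ V, ∃ p : MvPolynomial (Fin N) ℂ,
      M < (eval x p).re ∧ ∀ z ∈ K, ‖eval z p‖ ≤ M := by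
    rintro x ⟨-, hxV⟩
    have hx : x ∉ polyHull K := fun h => hxV (hKV (hhull ▸ h))
    simp only [polyHull, mem_ofPred_eq, not_forall, not_le] at hx
    obtain ⟨p, hp⟩ := hx
    set s := sSup ((fun x => ‖eval x p‖) '' K)
    have hs : ∀ z ∈ K, ‖eval z p‖ ≤ s := fun z hz => le_csSup
      (hK.image (contDiff_eval p).continuous.norm).bddAbove (mem_image_of_mem _ hz)
    have hs0 : 0 ≤ s := (norm_nonneg _).trans (hs _ hne.some_mem)
    set t := ‖eval x p‖
    have ht : 0 < t := hs0.trans_lt hp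
    have hx0 : eval x p ≠ 0 := norm_pos_iff.1 ht
    refine ⟨C ((2 * M * t / (t + s) : ℝ) / eval x p) * p, ?_, fun z hz => ?_⟩
    · rw [eval_mul, eval_C, div_mul_cancel₀ _ hx0, Complex.ofReal_re, lt_div_iff₀ (by positivity)]
      nlinarith
    · rw [eval_mul, eval_C, norm_mul, norm_div, Complex.norm_real, Real.norm_of_nonneg
        (by positivity), div_mul_eq_mul_div, div_le_iff₀ ht, div_mul_eq_mul_div,
        div_le_iff₀ (by positivity)]
      nlinarith [hs z hz, mul_pos hM ht]
  choose! P hP using hsep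
  obtain ⟨T, hT, hcov⟩ := ((isCompact_coordBox _ _).diff hV).elim_nhds_subcover
    (fun x => {y | M < (eval y (P x)).re}) fun x hx =>
      (isOpen_lt continuous_const (Complex.continuous_re.comp
        (contDiff_eval (P x)).continuous)).mem_nhds (hP x hx).1
  obtain ⟨q, hq⟩ := exists_polynomial_near_of_polyhedron hM (ps := T.toList.map P) rfl (f := g)
    (fun x hx => by
      refine contDiffAt_one_of_differentiableOn hV hg (by_contra fun hxV => ?_)
      obtain ⟨y, hy, hxy⟩ := mem_iUnion₂.1 (hcov ⟨hx.1, hxV⟩)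
      have := hx.2 (fun z => eval z (P y)) (by simpa using ⟨y, hy, rfl⟩)
      exact (lt_of_lt_of_le hxy (le_abs_self _)).not_ge this.1) hε
  refine ⟨q, fun z hz => hq z (hKM hz) ?_⟩
  simp only [List.forall_mem_map, Finset.mem_toList]
  exact fun y hy => (hP y (hT y hy)).2 z hz

/-- The polynomial functions on a compact set are separable for the uniform norm. -/
lemma exists_seq_polynomial_dense {K : Set (Fin N → ℂ)} (hK : IsCompact K) :
    ∃ P : ℕ → MvPolynomial (Fin N) ℂ, ∀ (q : MvPolynomial (Fin N) ℂ) {ε : ℝ}, 0 < ε →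
      ∃ j, ∀ z ∈ K, ‖eval z (P j) - eval z q‖ < ε := by
  have : CompactSpace K := isCompact_iff_compactSpace.1 hK
  let Φ : MvPolynomial (Fin N) ℂ → C(K, ℂ) := fun p =>
    ⟨fun z : K => eval (z : Fin N → ℂ) p, (contDiff_eval p).continuous.comp continuous_subtype_val⟩
  have : Nonempty (range Φ) := ⟨⟨Φ 0, 0, rfl⟩⟩
  choose P hP using fun j => (denseSeq (range Φ) j).2
  refine ⟨P, fun q ε hε => ?_⟩
  obtain ⟨j, hj⟩ := (denseRange_denseSeq (range Φ)).exists_dist_lt ⟨Φ q, q, rfl⟩ hε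
  refine ⟨j, fun z hz => ?_⟩
  rw [Subtype.dist_eq, ← hP j, dist_comm] at hj
  rw [← dist_eq_norm]
  exact (ContinuousMap.dist_apply_le_dist (f := Φ (P j)) (g := Φ q) ⟨z, hz⟩).trans_lt hj

/-- A countably-valued random compact set takes each of its values on a measurable set. -/
lemma measurableSet_fiber {Ω : Type*} [MeasurableSpace Ω] {X : Type*} [MetricSpace X]
    {K : Ω → NonemptyCompacts X} (hK : Measurable K) (A : NonemptyCompacts X) :
    MeasurableSet {ω | K ω = A} := by
  have : BorelSpace (NonemptyCompacts X) := ⟨rfl⟩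
  exact hK (measurableSet_singleton A)

end OkaWeil

/-- **Random Oka–Weil theorem (almost everywhere).** Let `(Ω, 𝒜, μ)` be a
σ-finite measure space and `K` a random compact set in `ℂⁿ` taking at most
countably many values, each of which is polynomially convex.  Let
`ε : Ω → ℝ` be a positive measurable function, and let `f` be a generalized
random function on `Gr K` such that each `f(ω, ·)` extends holomorphically
to an open neighbourhood of `K ω`.  Then there is a map `p` assigning to
each `ω` a polynomial, measurable in `ω` on `K⁻¹(z)` for each `z`, with
`max_{z ∈ K ω} |p(ω)(z) − f(ω, z)| < ε ω` for all `ω` outside a `μ`-null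
set `L`. -/
theorem random_oka_weil
    {Ω : Type*} [MeasurableSpace Ω] (μ : Measure Ω) [SigmaFinite μ] {n : ℕ}
    (K : Ω → NonemptyCompacts (Fin n → ℂ)) (hK : Measurable K)
    (hcount : (Set.range K).Countable)
    (hpoly : ∀ ω, (K ω : Set (Fin n → ℂ)) = polyHull (K ω))
    (ε : Ω → ℝ) (hε_meas : Measurable ε) (hε_pos : ∀ ω, 0 < ε ω)
    (f : Ω → (Fin n → ℂ) → ℂ)
    (hf_rand : ∀ z : Fin n → ℂ,
      Measurable fun ω : {ω : Ω // z ∈ (K ω : Set (Fin n → ℂ))} => f ω.1 z)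
    (hf_hol : ∀ ω, ∃ V : Set (Fin n → ℂ), IsOpen V ∧
      (K ω : Set (Fin n → ℂ)) ⊆ V ∧
      ∃ g : (Fin n → ℂ) → ℂ, DifferentiableOn ℂ g V ∧
        Set.EqOn g (f ω) (K ω : Set (Fin n → ℂ))) :
    ∃ p : Ω → MvPolynomial (Fin n) ℂ,
      (∀ z : Fin n → ℂ,
        Measurable fun ω : {ω : Ω // z ∈ (K ω : Set (Fin n → ℂ))} =>
          eval z (p ω.1)) ∧
      ∃ L : Set Ω, MeasurableSet L ∧ μ L = 0 ∧
        ∀ ω ∉ L, ∀ z ∈ (K ω : Set (Fin n → ℂ)),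
          ‖eval z (p ω) - f ω z‖ < ε ω := by
  classical
  choose P hP using fun A : NonemptyCompacts (Fin n → ℂ) => exists_seq_polynomial_dense A.isCompact
  have hne : ∀ A : NonemptyCompacts (Fin n → ℂ), Nonempty A := fun A => A.nonempty.to_subtype
  let D : (A : NonemptyCompacts (Fin n → ℂ)) → ℕ → A := fun A => denseSeq A
  let good : NonemptyCompacts (Fin n → ℂ) → Ω → ℕ → Prop := fun A ω j =>
    ∀ k, ‖eval (D A k : Fin n → ℂ) (P A j) - f ω (D A k)‖ ≤ ε ω / 2
  have hgood : ∀ ω, ∃ j, good (K ω) ω j := by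
    intro ω
    obtain ⟨V, hV, hKV, g, hg, hgf⟩ := hf_hol ω
    have hε : 0 < ε ω / 4 := by linarith [hε_pos ω]
    obtain ⟨q, hq⟩ := exists_polynomial_near_of_eq_polyHull (K ω).isCompact (K ω).nonempty
      (hpoly ω) hV hKV hg hε
    obtain ⟨j, hj⟩ := hP (K ω) q hε
    refine ⟨j, fun k => ?_⟩
    have hz := (D (K ω) k).2
    rw [← hgf hz]
    refine (norm_sub_le_norm_sub_add_norm_sub _ (eval (D (K ω) k : Fin n → ℂ) q) _).trans ?_
    linarith [hj _ hz, hq _ hz]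
  have hmeas : ∀ A j, MeasurableSet {ω | K ω = A ∧ good A ω j} := by
    intro A j
    have hA := measurableSet_fiber hK A
    have h1 : ∀ k, Measurable fun ω : {ω | K ω = A} => f ω.1 (D A k) := by
      intro k
      have hmem : ∀ ω : {ω | K ω = A}, (D A k : Fin n → ℂ) ∈ (K ω.1 : Set (Fin n → ℂ)) := by
        rintro ⟨ω, rfl⟩
        exact (D (K ω) k).2
      have hincl : Measurable fun ω : {ω | K ω = A} =>
          (⟨ω.1, hmem ω⟩ : {ω : Ω // (D A k : Fin n → ℂ) ∈ (K ω : Set (Fin n → ℂ))}) :=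
        measurable_subtype_coe.subtype_mk
      exact (hf_rand (D A k)).comp hincl
    have h2 : MeasurableSet {ω : {ω | K ω = A} | good A ω j} := by
      simp only [good, Set.ofPred_forall]
      exact MeasurableSet.iInter fun k => measurableSet_le (measurable_const.sub (h1 k)).norm
        ((hε_meas.comp measurable_subtype_coe).div_const 2)
    have h3 : {ω | K ω = A ∧ good A ω j} =
        Subtype.val '' {ω : {ω | K ω = A} | good A ω j} := by
      ext ω
      refine ⟨fun h => ⟨⟨ω, h.1⟩, h.2, rfl⟩, ?_⟩
      rintro ⟨x, hx, rfl⟩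
      exact ⟨x.2, hx⟩
    rw [h3]
    exact hA.subtype_image h2
  let j : Ω → ℕ := fun ω => Nat.find (hgood ω)
  refine ⟨fun ω => P (K ω) (j ω), fun z => ?_, ∅, MeasurableSet.empty, measure_empty,
    fun ω _ z hz => ?_⟩
  · suffices Measurable fun ω => eval z (P (K ω) (j ω)) from this.comp measurable_subtype_coe
    intro s _
    have : (fun ω => eval z (P (K ω) (j ω))) ⁻¹' s =
        ⋃ A ∈ Set.range K, ⋃ i, ⋃ _ : eval z (P A i) ∈ s,
          {ω | K ω = A ∧ good A ω i} \ ⋃ i' < i, {ω | K ω = A ∧ good A ω i'} := by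
      have hj : ∀ ω i, j ω = i ↔ good (K ω) ω i ∧ ∀ i' < i, ¬ good (K ω) ω i' := fun ω i =>
        Nat.find_eq_iff (hgood ω)
      ext ω
      simp only [Set.mem_preimage, Set.mem_iUnion, Set.mem_sdiff, Set.mem_ofPred_eq, exists_prop]
      constructor
      · intro hs
        obtain ⟨h1, h2⟩ := (hj ω _).1 rfl
        exact ⟨K ω, ⟨ω, rfl⟩, j ω, hs, ⟨rfl, h1⟩, fun ⟨i', hi', _, h3⟩ => h2 i' hi' h3⟩
      · rintro ⟨A, -, i, hs, ⟨rfl, h1⟩, h2⟩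
        rwa [(hj ω i).2 ⟨h1, fun i' hi' h3 => h2 ⟨i', hi', rfl, h3⟩⟩]
    rw [this]
    exact MeasurableSet.biUnion hcount fun A _ => MeasurableSet.iUnion fun i =>
      MeasurableSet.iUnion fun _ => (hmeas A i).diff
        (MeasurableSet.iUnion fun i' => MeasurableSet.iUnion fun _ => hmeas A i')
  · obtain ⟨V, hV, hKV, g, hg, hgf⟩ := hf_hol ω
    have hcont : Continuous fun x : K ω => f ω x :=
      continuousOn_iff_continuous_domRestrict.1 ((hg.continuousOn.mono hKV).congr hgf.symm)
    have hle : ∀ x : K ω, ‖eval (x : Fin n → ℂ) (P (K ω) (j ω)) - f ω x‖ ≤ ε ω / 2 := by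
      intro x
      refine (denseRange_denseSeq (K ω)).induction_on
        (p := fun x : K ω => ‖eval (x : Fin n → ℂ) (P (K ω) (j ω)) - f ω x‖ ≤ ε ω / 2) x
        (isClosed_le ((((contDiff_eval _).continuous.comp continuous_subtype_val).sub hcont).norm)
          continuous_const) fun k => Nat.find_spec (hgood ω) k
    exact (hle ⟨z, hz⟩).trans_lt (half_lt_self (hε_pos ω))
end
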